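/- arXiv:1404.3911 — 4 statements merged into one kernel-verified Lean document; each statement's English description precedes it below -/
import Mathlib

section
/- Let r ≥ 2 and d₁ ≥ d₂ ≥ ⋯ ≥ d_r ≥ 1 be integers with d₁ < s, where s = d₂+⋯+d_r; set d = d₁+⋯+d_r and D = Σ_{1≤i<j≤r} d_i d_j. Then C(d+2,2) ≤ 2D if and only if one of the following holds: [d₁,…,d_r] ⪰ [4,3,3]; [d₁,…,d_r] ⪰ [6,6,2]; [d₁,…,d_r] ⪰ [4,4,1,1]; [d₁,…,d_r] ⪰ [2,2,2,1]; [d₁,…,d_r] ⪰ [2,1,1,1,1]; or r ≥ 6. (Arithmetic content of Proposition 4.7(ii): since the generic dimension of (I_Z)_d equals max{0, C(d+2,2) − 2D} when d₁ < s, these are exactly the cases with dim (I_Z)_d = 0.) -/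
open Finset

/-- `D = Σ_{1 ≤ i < j ≤ r} d_i d_j`. -/
def Dval {r : ℕ} (d : Fin r → ℕ) : ℕ :=
  ∑ q ∈ univ.filter (fun q : Fin r × Fin r => q.1 < q.2), d q.1 * d q.2

/-- `s = d_2 + ⋯ + d_r`. -/
def sval {r : ℕ} (d : Fin r → ℕ) : ℕ :=
  ∑ i ∈ univ.filter (fun i : Fin r => i.val ≠ 0), d i

/-- `p = Σ_{2 ≤ i < j ≤ r} d_i d_j = D - d_1 s`. -/
def pval {r : ℕ} (d : Fin r → ℕ) : ℕ :=
  ∑ q ∈ univ.filter (fun q : Fin r × Fin r => q.1 < q.2 ∧ q.1.val ≠ 0), d q.1 * d q.2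

theorem two_mul_Dval_add_sum_sq {r : ℕ} (d : Fin r → ℕ) :
    2 * Dval d + ∑ i, d i ^ 2 = (∑ i, d i) ^ 2 := by
  have swap : ∑ i, ∑ j, (if i < j then d i * d j else 0) =
      ∑ i, ∑ j, if j < i then d i * d j else 0 := by
    rw [sum_comm]
    simp only [mul_comm]
  have diag : ∑ i, d i ^ 2 = ∑ i, ∑ j, if i = j then d i * d j else 0 := by
    simp [sq]
  rw [Dval, sum_filter, ← univ_product_univ, sum_product, two_mul, diag]
  nth_rewrite 2 [swap]
  rw [sq, sum_mul_sum]
  simp only [← sum_add_distrib]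
  refine sum_congr rfl fun i _ ↦ sum_congr rfl fun j _ ↦ ?_
  rcases lt_trichotomy i j with h | rfl | h
  · simp [h, h.not_gt, h.ne]
  · simp
  · simp [h, h.not_gt, h.ne']

theorem sval_succ {n : ℕ} (d : Fin (n + 1) → ℕ) : sval d = ∑ i : Fin n, d i.succ := by
  simp [sval, sum_filter, Fin.sum_univ_succ]

theorem choose_two_le_iff (n m : ℕ) :
    (n + 2).choose 2 ≤ 2 * m ↔ (n : ℤ) ^ 2 + 3 * n + 2 ≤ 4 * m := by
  have h : (n + 2).choose 2 * 2 = (n + 2) * (n + 1) := by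
    rw [Nat.choose_two_right]
    exact Nat.div_mul_cancel (Nat.even_mul_pred_self (n + 2)).two_dvd
  zify at h ⊢
  constructor <;> intro <;> linarith

/-- The inequality in terms of the first two entries and of the sum and the sum of squares of the
other ones. Its left side is small when `d 0` is close to `s`. -/
theorem choose_two_le_two_mul_Dval_iff {n : ℕ} (d : Fin (n + 2) → ℕ) :
    ((∑ i, d i) + 2).choose 2 ≤ 2 * Dval d ↔
      (d 1 + ∑ i : Fin n, (d i.succ.succ : ℤ) - 1 - d 0) *
            (d 1 + ∑ i : Fin n, (d i.succ.succ : ℤ) - 2 - d 0) +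
          2 * ∑ i : Fin n, (d i.succ.succ : ℤ) ^ 2 + 6 * (d 1 + ∑ i : Fin n, (d i.succ.succ : ℤ))
        ≤ 4 * d 1 * ∑ i : Fin n, (d i.succ.succ : ℤ) +
          2 * (∑ i : Fin n, (d i.succ.succ : ℤ)) ^ 2 := by
  have h := two_mul_Dval_add_sum_sq d
  rw [choose_two_le_iff]
  zify at h
  simp only [Fin.sum_univ_succ, Fin.succ_zero_eq_one, ← add_assoc, Nat.cast_add, Nat.cast_sum]
    at h ⊢
  constructor <;> intro <;> linarith

theorem quadratic_le_of_four_le {a b t q : ℤ} (hb : 1 ≤ b) (hba : b ≤ a) (hat : a < b + t)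
    (ht : 4 ≤ t) (hq : q ≤ b * t) :
    (b + t - 1 - a) * (b + t - 2 - a) + 2 * q + 6 * (b + t) ≤ 4 * b * t + 2 * t ^ 2 := by
  nlinarith [mul_nonneg (sub_nonneg.2 hba) (show 0 ≤ 2 * t + b - 3 - a by linarith),
    mul_nonneg (show 0 ≤ b - 1 by linarith) (show 0 ≤ t - 4 by linarith), sq_nonneg (t - 4)]

theorem quadratic_three_le_iff {a b c : ℤ} (hc : 1 ≤ c) (hcb : c ≤ b) (hba : b ≤ a)
    (ha : a < b + c) :
    (b + c - 1 - a) * (b + c - 2 - a) + 2 * c ^ 2 + 6 * (b + c) ≤ 4 * b * c + 2 * c ^ 2 ↔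
      4 ≤ a ∧ 3 ≤ b ∧ 3 ≤ c ∨ 6 ≤ a ∧ 6 ≤ b ∧ 2 ≤ c := by
  obtain ht | ht := le_or_gt 4 c
  · exact iff_of_true (quadratic_le_of_four_le (by omega) hba ha ht (by nlinarith)) (by omega)
  · obtain ⟨k, rfl⟩ : ∃ k, a = b + k := ⟨a - b, by ring⟩
    have hk : 0 ≤ k := by omega
    have hkc : k < c := by omega
    interval_cases c <;> interval_cases k <;> omega

theorem quadratic_four_le_iff {a b c e : ℤ} (he : 1 ≤ e) (hec : e ≤ c) (hcb : c ≤ b)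
    (hba : b ≤ a) (ha : a < b + (c + e)) :
    (b + (c + e) - 1 - a) * (b + (c + e) - 2 - a) + 2 * (c ^ 2 + e ^ 2) + 6 * (b + (c + e))
        ≤ 4 * b * (c + e) + 2 * (c + e) ^ 2 ↔
      4 ≤ a ∧ 4 ≤ b ∧ 1 ≤ c ∧ 1 ≤ e ∨ 2 ≤ a ∧ 2 ≤ b ∧ 2 ≤ c ∧ 1 ≤ e := by
  obtain ht | ht := le_or_gt 4 (c + e)
  · exact iff_of_true (quadratic_le_of_four_le (by omega) hba ha ht (by nlinarith)) (by omega)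
  · obtain ⟨k, rfl⟩ : ∃ k, a = b + k := ⟨a - b, by ring⟩
    have hk : 0 ≤ k := by omega
    have hkc : k < c + e := by omega
    obtain rfl : e = 1 := by omega
    have hc : c < 3 := by omega
    interval_cases c <;> interval_cases k <;> omega

theorem quadratic_five_le_iff {a b c e g : ℤ} (hg : 1 ≤ g) (hge : g ≤ e) (hec : e ≤ c)
    (hcb : c ≤ b) (hba : b ≤ a) (ha : a < b + (c + (e + g))) :
    (b + (c + (e + g)) - 1 - a) * (b + (c + (e + g)) - 2 - a) + 2 * (c ^ 2 + (e ^ 2 + g ^ 2)) +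
          6 * (b + (c + (e + g)))
        ≤ 4 * b * (c + (e + g)) + 2 * (c + (e + g)) ^ 2 ↔
      2 ≤ a ∧ 1 ≤ b ∧ 1 ≤ c ∧ 1 ≤ e ∧ 1 ≤ g := by
  obtain ht | ht := le_or_gt 4 (c + (e + g))
  · exact iff_of_true (quadratic_le_of_four_le (by omega) hba ha ht (by nlinarith)) (by omega)
  · obtain ⟨k, rfl⟩ : ∃ k, a = b + k := ⟨a - b, by ring⟩
    have hk : 0 ≤ k := by omega
    have hkc : k < 3 := by omega
    obtain ⟨rfl, rfl, rfl⟩ : c = 1 ∧ e = 1 ∧ g = 1 := by omega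
    interval_cases k <;> omega

/-- Arithmetic content of Proposition 4.7(ii): for `d₁ < s`, `C(d+2,2) ≤ 2D` holds
exactly in the listed cases. -/
theorem expected_dim_zero_classification
    (r : ℕ) [NeZero r] (hr : 2 ≤ r)
    (d : Fin r → ℕ)
    (hanti : ∀ i j : Fin r, i ≤ j → d j ≤ d i)
    (hpos : ∀ i, 1 ≤ d i)
    (hds : d 0 < sval d) :
    ((∑ i, d i) + 2).choose 2 ≤ 2 * Dval d ↔
      ((r = 3 ∧ 4 ≤ d 0 ∧ 3 ≤ d 1 ∧ 3 ≤ d 2) ∨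
      (r = 3 ∧ 6 ≤ d 0 ∧ 6 ≤ d 1 ∧ 2 ≤ d 2) ∨
      (r = 4 ∧ 4 ≤ d 0 ∧ 4 ≤ d 1 ∧ 1 ≤ d 2 ∧ 1 ≤ d 3) ∨
      (r = 4 ∧ 2 ≤ d 0 ∧ 2 ≤ d 1 ∧ 2 ≤ d 2 ∧ 1 ≤ d 3) ∨
      (r = 5 ∧ 2 ≤ d 0 ∧ 1 ≤ d 1 ∧ 1 ≤ d 2 ∧ 1 ≤ d 3 ∧ 1 ≤ d 4) ∨
      6 ≤ r) := by
  obtain ⟨n, rfl⟩ := Nat.exists_eq_add_of_le' hr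
  rw [choose_two_le_two_mul_Dval_iff]
  have hba : (d 1 : ℤ) ≤ d 0 := mod_cast hanti 0 1 (Fin.zero_le _)
  have hb : (1 : ℤ) ≤ d 1 := mod_cast hpos 1
  have hat : (d 0 : ℤ) < d 1 + ∑ i : Fin n, (d i.succ.succ : ℤ) := by
    rw [sval_succ, Fin.sum_univ_succ] at hds
    exact_mod_cast hds
  have hq : ∑ i : Fin n, (d i.succ.succ : ℤ) ^ 2 ≤ d 1 * ∑ i : Fin n, (d i.succ.succ : ℤ) := by
    rw [mul_sum]
    refine sum_le_sum fun i _ ↦ ?_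
    have h : (d i.succ.succ : ℤ) ≤ d 1 :=
      mod_cast hanti 1 i.succ.succ (Fin.succ_le_succ_iff.2 (Fin.zero_le _))
    rw [sq]
    gcongr
  obtain hn | hn := le_or_gt 4 n
  · have ht : (n : ℤ) ≤ ∑ i : Fin n, (d i.succ.succ : ℤ) := by
      have h := sum_le_sum fun (i : Fin n) (_ : i ∈ univ) ↦ hpos i.succ.succ
      simp only [sum_const, card_univ, Fintype.card_fin, smul_eq_mul, mul_one] at h
      exact_mod_cast h
    have hn' : (4 : ℤ) ≤ n := mod_cast hn
    exact iff_of_true (quadratic_le_of_four_le hb hba hat (hn'.trans ht) hq) (by omega)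
  · interval_cases n
    · simp at hat
      omega
    · have h := quadratic_three_le_iff (a := d 0) (b := d 1) (c := d 2)
        (mod_cast hpos 2)
        (mod_cast hanti 1 2 (by simp [Fin.le_def])) hba
      simp only [Fin.sum_univ_succ, univ_eq_empty, sum_empty, add_zero] at hat ⊢
      refine (h hat).trans ?_
      norm_cast
      simp
    · have h := quadratic_four_le_iff (a := d 0) (b := d 1) (c := d 2) (e := d 3)
        (mod_cast hpos 3)
        (mod_cast hanti 2 3 (by simp [Fin.le_def]))
        (mod_cast hanti 1 2 (by simp [Fin.le_def])) hba
      simp only [Fin.sum_univ_succ, univ_eq_empty, sum_empty, add_zero] at hat ⊢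
      refine (h hat).trans ?_
      norm_cast
      simp
    · have h := quadratic_five_le_iff (a := d 0) (b := d 1) (c := d 2) (e := d 3) (g := d 4)
        (mod_cast hpos 4)
        (mod_cast hanti 3 4 (by simp [Fin.le_def]))
        (mod_cast hanti 2 3 (by simp [Fin.le_def]))
        (mod_cast hanti 1 2 (by simp [Fin.le_def])) hba
      simp only [Fin.sum_univ_succ, univ_eq_empty, sum_empty, add_zero] at hat ⊢
      refine (h hat).trans ?_
      norm_cast
      simp
end

section
/- Let k be an algebraically closed field and let r > 2 and d₁ ≥ d₂ ≥ ⋯ ≥ d_r ≥ 1 be integers with d₁ ≥ s−1 and 2p − 3s ≤ 0 (where s = d₂+⋯+d_r, D = Σ_{1≤i<j≤r} d_i d_j, p = D − d₁s, d = d₁+⋯+d_r). Then C(d+2,2) − 2D = C(d₁−s+2,2) + 3s − 2p ≥ 0, and there exist nonzero homogeneous polynomials F₁,…,F_r, G₁,…,G_r ∈ k[x₀,x₁,x₂] with deg F_i = deg G_i = d_i such that dim_k (I_F ∩ I_G)_d = C(d+2,2) − 2D. (Lemma 4.9: if d₁ ≥ s−1 and 2p ≤ 3s then (I_Z)_d has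 the expected dimension.) -/
open MvPolynomial Finset

/-- The ideal `I_F = ⋂_{i<j} (F_i, F_j)` associated to a tuple of forms. -/
noncomputable def idealOfForms {k : Type*} [Field k] {r : ℕ}
    (F : Fin r → MvPolynomial (Fin 3) k) : Ideal (MvPolynomial (Fin 3) k) :=
  ⨅ (i : Fin r) (j : Fin r) (_ : i < j), Ideal.span {F i, F j}

/-- `dim_k (I)_n`, the dimension of the degree-`n` homogeneous part of the ideal `I`. -/
noncomputable def gradedDim {k : Type*} [Field k]
    (I : Ideal (MvPolynomial (Fin 3) k)) (n : ℕ) : ℕ :=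
  Module.finrank k
    ↥(Submodule.restrictScalars k I ⊓ homogeneousSubmodule (Fin 3) k n)

section Points

open Matrix

variable {k : Type*} [Field k]

/-- The linear form with coefficient vector `L`. -/
noncomputable def linForm (L : Fin 3 → k) : MvPolynomial (Fin 3) k :=
  ∑ i, C (L i) * X i

lemma eval_linForm (L P : Fin 3 → k) : eval P (linForm L) = L ⬝ᵥ P := by
  simp [linForm, dotProduct]

lemma isHomogeneous_linForm (L : Fin 3 → k) : (linForm L).IsHomogeneous 1 :=
  IsHomogeneous.sum _ _ _ fun i _ => by
    simpa using (isHomogeneous_C (Fin 3) (L i)).mul (isHomogeneous_X k i)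

/-- The points of a list impose independent conditions on forms of degree `n`. -/
def Indep (n : ℕ) : List (Fin 3 → k) → Prop
  | [] => True
  | P :: l => (∃ f : MvPolynomial (Fin 3) k, f.IsHomogeneous n ∧ eval P f ≠ 0 ∧
      ∀ Q ∈ l, eval Q f = 0) ∧ Indep n l

/-- Two coordinate vectors are not proportional. -/
def NonProp (P Q : Fin 3 → k) : Prop := P ⨯₃ Q ≠ 0

lemma NonProp.symm {P Q : Fin 3 → k} (h : NonProp P Q) : NonProp Q P := by
  unfold NonProp at *
  rwa [← cross_anticomm, neg_ne_zero]

lemma Indep.perm {n : ℕ} {l l' : List (Fin 3 → k)} (h : l.Perm l') (hl : Indep n l) :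
    Indep n l' := by
  induction h with
  | nil => exact hl
  | cons P hp ih =>
    obtain ⟨⟨f, hf, hP, hQ⟩, hl⟩ := hl
    exact ⟨⟨f, hf, hP, fun Q h => hQ Q (hp.mem_iff.2 h)⟩, ih hl⟩
  | swap P Q l =>
    obtain ⟨⟨f, hf, hfQ, hfl⟩, ⟨g, hg, hgP, hgl⟩, hl⟩ := hl
    have hfP := hfl P (by simp)
    refine ⟨⟨C (eval Q f) * g - C (eval Q g) * f, ?_, ?_, ?_⟩,
      ⟨f, hf, hfQ, fun R hR => hfl R (by simp [hR])⟩, hl⟩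
    · simpa using ((isHomogeneous_C (Fin 3) (eval Q f)).mul hg).sub
        ((isHomogeneous_C (Fin 3) (eval Q g)).mul hf)
    · simp [hfP, hfQ, hgP]
    · intro R hR
      rcases List.mem_cons.1 hR with rfl | hR
      · simp [mul_comm]
      · simp [hgl R hR, hfl R (by simp [hR])]
  | trans _ _ ih₁ ih₂ => exact ih₂ (ih₁ hl)

lemma Indep.peel {n : ℕ} {l₁ l₂ : List (Fin 3 → k)} (L : Fin 3 → k) (h₁ : Indep n l₁)
    (hoff : ∀ P ∈ l₁, L ⬝ᵥ P ≠ 0) (hon : ∀ P ∈ l₂, L ⬝ᵥ P = 0) (h₂ : Indep (n + 1) l₂) :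
    Indep (n + 1) (l₁ ++ l₂) := by
  induction l₁ with
  | nil => exact h₂
  | cons P l ih =>
    obtain ⟨⟨f, hf, hfP, hfl⟩, hl⟩ := h₁
    refine ⟨⟨f * linForm L, hf.mul (isHomogeneous_linForm L), ?_, ?_⟩,
      ih hl fun Q hQ => hoff Q (by simp [hQ])⟩
    · simp [eval_linForm, hfP, hoff P (by simp)]
    · intro Q hQ
      rcases List.mem_append.1 hQ with hQ | hQ
      · simp [hfl Q hQ]
      · simp [eval_linForm, hon Q hQ]

lemma Indep.ne_zero {n : ℕ} (hn : n ≠ 0) {l : List (Fin 3 → k)} (h : Indep n l) :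
    ∀ P ∈ l, P ≠ 0 := by
  induction l with
  | nil => simp
  | cons P l ih =>
    obtain ⟨⟨f, hf, hfP, -⟩, hl⟩ := h
    intro Q hQ
    rcases List.mem_cons.1 hQ with rfl | hQ
    · rintro rfl
      exact hfP (by
        simpa [constantCoeff_eq] using hf.coeff_eq_zero (d := 0) (by simpa using hn.symm))
    · exact ih hl Q hQ

/-- If two nonzero vectors are proportional then one is a multiple of the other. -/
lemma exists_smul_of_cross_eq_zero {P Q : Fin 3 → k} (hQ : Q ≠ 0) (h : P ⨯₃ Q = 0) :
    ∃ c : k, P = c • Q := by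
  by_contra! hc
  refine crossProduct_ne_zero_iff_linearIndependent.2 ?_ h
  rw [LinearIndependent.pair_iff]
  intro a b hab
  have ha : a = 0 := by
    by_contra ha
    refine hc (-(a⁻¹ * b)) ?_
    have : a • P = -(b • Q) := eq_neg_of_add_eq_zero_left hab
    calc P = a⁻¹ • (a • P) := by simp [smul_smul, ha]
      _ = _ := by rw [this]; simp [smul_smul]
  subst ha
  simpa [hQ] using hab

lemma eval_smul_of_isHomogeneous {n : ℕ} {f : MvPolynomial (Fin 3) k} (hf : f.IsHomogeneous n)
    (c : k) (P : Fin 3 → k) : eval (c • P) f = c ^ n * eval P f := by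
  rw [eval_eq', eval_eq', Finset.mul_sum]
  refine Finset.sum_congr rfl fun m hm => ?_
  have h := hf.degree_eq_sum_deg_support hm
  simp only [Pi.smul_apply, smul_eq_mul, mul_pow, Finset.prod_mul_distrib,
    Finset.prod_pow_eq_pow_sum]
  rw [show ∑ i, m i = n from
    h ▸ (Finset.sum_subset (subset_univ _) (by simp)).symm]
  ring

lemma Indep.pairwise_nonProp {n : ℕ} (hn : n ≠ 0) {l : List (Fin 3 → k)} (h : Indep n l) :
    l.Pairwise NonProp := by
  induction l with
  | nil => simp
  | cons P l ih =>
    have h0 := h.ne_zero hn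
    obtain ⟨⟨f, hf, hfP, hfl⟩, hl⟩ := h
    refine List.pairwise_cons.2 ⟨fun Q hQ hPQ => ?_, ih hl⟩
    obtain ⟨c, rfl⟩ := exists_smul_of_cross_eq_zero (h0 Q (by simp [hQ])) hPQ
    rw [eval_smul_of_isHomogeneous hf, hfl Q hQ] at hfP
    simp at hfP

lemma exists_dotProduct_eq_zero_of_nonProp {P Q : Fin 3 → k} (h : NonProp P Q) :
    ∃ L : Fin 3 → k, L ⬝ᵥ Q = 0 ∧ L ⬝ᵥ P ≠ 0 := by
  by_contra! hc
  have hx (v : Fin 3 → k) : (Q ⨯₃ v) ⬝ᵥ P = 0 := hc _ (by rw [dotProduct_comm, dot_self_cross])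
  refine h ?_
  have hv (v : Fin 3 → k) : v ⬝ᵥ P ⨯₃ Q = 0 := by
    rw [triple_product_permutation, dotProduct_comm]
    exact hx v
  ext i
  simpa using hv (Pi.single i 1)

lemma exists_form_of_nonProp {P : Fin 3 → k} (hP : P ≠ 0) {l : List (Fin 3 → k)}
    (hl : ∀ Q ∈ l, NonProp P Q) {n : ℕ} (hn : l.length ≤ n) :
    ∃ f : MvPolynomial (Fin 3) k, f.IsHomogeneous n ∧ eval P f ≠ 0 ∧ ∀ Q ∈ l, eval Q f = 0 := by
  induction n generalizing l with
  | zero =>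
    obtain rfl : l = [] := by simpa using hn
    exact ⟨1, isHomogeneous_one _ _, by simp, by simp⟩
  | succ n ih =>
    cases l with
    | nil =>
      obtain ⟨i, hi⟩ := Function.ne_iff.1 hP
      obtain ⟨f, hf, hfP, -⟩ := ih (l := []) (by simp) (by simp)
      exact ⟨f * X i, hf.mul (isHomogeneous_X _ _), by simpa using ⟨hfP, hi⟩, by simp⟩
    | cons Q l =>
      obtain ⟨f, hf, hfP, hfl⟩ := ih (l := l) (fun R hR => hl R (by simp [hR])) (by simpa using hn)
      obtain ⟨L, hLQ, hLP⟩ := exists_dotProduct_eq_zero_of_nonProp (hl Q (by simp))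
      refine ⟨f * linForm L, hf.mul (isHomogeneous_linForm L), ?_, ?_⟩
      · simpa [eval_linForm] using ⟨hfP, hLP⟩
      · intro R hR
        rcases List.mem_cons.1 hR with rfl | hR
        · simp [eval_linForm, hLQ]
        · simp [hfl R hR]

lemma Indep.of_length_le {n : ℕ} {l : List (Fin 3 → k)} (h0 : ∀ P ∈ l, P ≠ 0)
    (hp : l.Pairwise NonProp) (hn : l.length ≤ n + 1) : Indep n l := by
  induction l with
  | nil => trivial
  | cons P l ih =>
    rw [List.pairwise_cons] at hp
    simp only [List.length_cons] at hn
    exact ⟨exists_form_of_nonProp (h0 P (by simp)) hp.1 (by omega),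
      ih (fun Q hQ => h0 Q (by simp [hQ])) hp.2 (by omega)⟩

/-- Forms of degree `n` vanishing at the points of `l`. -/
noncomputable def vanishing (n : ℕ) (l : List (Fin 3 → k)) :
    Submodule k (MvPolynomial (Fin 3) k) where
  carrier := {f | f.IsHomogeneous n ∧ ∀ P ∈ l, eval P f = 0}
  zero_mem' := ⟨isHomogeneous_zero _ _ _, by simp⟩
  add_mem' := fun hf hg => ⟨hf.1.add hg.1, fun P hP => by simp [hf.2 P hP, hg.2 P hP]⟩
  smul_mem' := fun c f hf => ⟨(homogeneousSubmodule (Fin 3) k n).smul_mem c hf.1,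
    fun P hP => by simp [smul_eval, hf.2 P hP]⟩

lemma finrank_homogeneousSubmodule (n : ℕ) :
    Module.finrank k (homogeneousSubmodule (Fin 3) k n) = (n + 2).choose 2 := by
  have hs : {d : Fin 3 →₀ ℕ | d.degree = n} =
      ↑(Finset.univ.finsuppAntidiag n : Finset (Fin 3 →₀ ℕ)) := by
    ext d; simp [Finsupp.degree_eq_sum]
  rw [homogeneousSubmodule_eq_finsupp_supported, hs]
  rw [(AddMonoidAlgebra.supportedEquivFinsupp _).finrank_eq, Module.finrank_finsupp_self]
  simp only [coe_sort_coe, Fintype.card_coe, card_finsuppAntidiag_nat_eq_choose, card_univ,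
    Fintype.card_fin]
  rw [show 3 + n - 1 = n + 2 by omega, ← Nat.choose_symm_add]

instance finite_homogeneousSubmodule (n : ℕ) :
    Module.Finite k (homogeneousSubmodule (Fin 3) k n) :=
  Module.Finite.iff_fg.2 (homogeneousSubmodule_fg (Fin 3) k n)

lemma finrank_vanishing_add_length {n : ℕ} {l : List (Fin 3 → k)} (h : Indep n l) :
    Module.finrank k (vanishing n l) + l.length = (n + 2).choose 2 := by
  induction l with
  | nil =>
    rw [← finrank_homogeneousSubmodule (k := k) n]
    have : vanishing n ([] : List (Fin 3 → k)) = homogeneousSubmodule (Fin 3) k n := by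
      ext f; simp [vanishing]
    rw [this]; rfl
  | cons P l ih =>
    obtain ⟨⟨f, hf, hfP, hfl⟩, hl⟩ := h
    have hle : vanishing n l ≤ homogeneousSubmodule (Fin 3) k n := fun g hg => hg.1
    have : Module.Finite k (vanishing n l) := Submodule.finiteDimensional_of_le hle
    let φ : Module.Dual k (vanishing n l) :=
      (MvPolynomial.aeval (R := k) P).toLinearMap ∘ₗ (vanishing n l).subtype
    have hφ : φ ≠ 0 := fun h0 => hfP (by simpa [φ] using DFunLike.congr_fun h0 ⟨f, hf, hfl⟩)
    have h1 := Module.Dual.finrank_ker_add_one_of_ne_zero hφ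
    have h2 : Module.finrank k (vanishing n (P :: l)) = Module.finrank k (LinearMap.ker φ) := by
      have : vanishing n (P :: l) = (LinearMap.ker φ).map (vanishing n l).subtype := by
        ext g
        simp only [Submodule.mem_map, LinearMap.mem_ker, Submodule.subtype_apply, Subtype.exists,
          exists_and_right, exists_eq_right]
        constructor
        · intro hg
          exact ⟨⟨hg.1, fun Q hQ => hg.2 Q (by simp [hQ])⟩, by simpa [φ] using hg.2 P (by simp)⟩
        · rintro ⟨hg, h⟩
          refine ⟨hg.1, fun Q hQ => ?_⟩
          rcases List.mem_cons.1 hQ with rfl | hQ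
          · simpa [φ] using h
          · exact hg.2 Q hQ
      rw [this]
      exact (LinearEquiv.finrank_eq (Submodule.equivMapOfInjective _
        (Submodule.injective_subtype _) _)).symm
    rw [← ih hl]
    simp only [List.length_cons]
    omega

end Points

section Configurations

open Matrix

variable {k : Type*} [Field k] {ι : Type*} [DecidableEq ι]

/-- The intersection points of lines of different classes in an arrangement of labelled lines. -/
def pts : List (ι × (Fin 3 → k)) → List (Fin 3 → k)
  | [] => []
  | (c, L) :: F => (F.filter (·.1 ≠ c)).map (fun x => L ⨯₃ x.2) ++ pts F

/-- The lines of class `i`. -/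
def classLines (F : List (ι × (Fin 3 → k))) (i : ι) : List (Fin 3 → k) :=
  (F.filter (·.1 = i)).map Prod.snd

/-- The product of the linear forms in a list. -/
noncomputable def prodForm (l : List (Fin 3 → k)) : MvPolynomial (Fin 3) k :=
  (l.map linForm).prod

lemma mem_classLines {K : Type*} {F : List (ι × (Fin 3 → K))} {i : ι} {L : Fin 3 → K} :
    L ∈ classLines F i ↔ (i, L) ∈ F := by
  simp [classLines]

lemma linForm_smul_add (a b : k) (X Y : Fin 3 → k) :
    linForm (a • X + b • Y) = C a * linForm X + C b * linForm Y := by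
  simp only [linForm, Pi.add_apply, Pi.smul_apply, smul_eq_mul, map_add, map_mul, add_mul,
    Finset.sum_add_distrib, Finset.mul_sum, mul_assoc]

lemma linForm_single (i : Fin 3) : linForm (Pi.single i (1 : k)) = X i := by
  simp [linForm, Pi.single_apply]

lemma linForm_ne_zero {L : Fin 3 → k} (hL : L ≠ 0) : linForm L ≠ 0 := by
  intro h
  refine hL (funext fun i => ?_)
  simpa [h] using (eval_linForm L (Pi.single i 1)).symm

lemma isHomogeneous_prodForm (l : List (Fin 3 → k)) : (prodForm l).IsHomogeneous l.length := by
  induction l with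
  | nil => exact isHomogeneous_one _ _
  | cons L l ih =>
    simpa [prodForm, add_comm] using (isHomogeneous_linForm L).mul ih

lemma prodForm_ne_zero {l : List (Fin 3 → k)} (h : ∀ L ∈ l, L ≠ 0) : prodForm l ≠ 0 := by
  refine List.prod_ne_zero fun h0 => ?_
  obtain ⟨L, hL, h1⟩ := List.mem_map.1 h0
  exact linForm_ne_zero (h L hL) h1

lemma eval_prodForm_eq_zero {l : List (Fin 3 → k)} {L P : Fin 3 → k} (hL : L ∈ l)
    (h : L ⬝ᵥ P = 0) : eval P (prodForm l) = 0 := by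
  obtain ⟨s, t, rfl⟩ := List.append_of_mem hL
  simp [prodForm, eval_linForm, h]

/-- Restriction of polynomials to the line spanned by `P`. -/
noncomputable def restrictLine (P : Fin 3 → k) : MvPolynomial (Fin 3) k →ₐ[k] Polynomial k :=
  aeval fun i => Polynomial.C (P i) * Polynomial.X

lemma restrictLine_linForm (P L : Fin 3 → k) :
    restrictLine P (linForm L) = Polynomial.C (L ⬝ᵥ P) * Polynomial.X := by
  simp [restrictLine, linForm, dotProduct, Finset.sum_mul, mul_assoc]

lemma restrictLine_eq_zero_iff {n : ℕ} {f : MvPolynomial (Fin 3) k} (hf : f.IsHomogeneous n)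
    (P : Fin 3 → k) : restrictLine P f = 0 ↔ eval P f = 0 := by
  have : restrictLine P f = Polynomial.C (eval P f) * Polynomial.X ^ n := by
    rw [restrictLine, aeval_def, eval₂_eq', eval_eq', map_sum, Finset.sum_mul]
    refine Finset.sum_congr rfl fun m hm => ?_
    simp only [mul_pow, Finset.prod_mul_distrib,
    Finset.prod_pow_eq_pow_sum]
    rw [show ∑ i, m i = n from hf.degree_eq_sum_deg_support hm ▸
      (Finset.sum_subset (subset_univ _) (by simp)).symm]
    simp [mul_assoc]
  simp [this]

lemma exists_eq_smul_add_smul {X Y v : Fin 3 → k} (h : X ⨯₃ Y ≠ 0) (hv : v ⬝ᵥ X ⨯₃ Y = 0) :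
    ∃ a b : k, v = a • X + b • Y := by
  obtain ⟨m, hm⟩ := Function.ne_iff.1 h
  set P := X ⨯₃ Y with hP
  set u : Fin 3 → k := Pi.single m (P m)⁻¹ with hu
  have huP : u ⬝ᵥ P = 1 := by simpa [hu] using inv_mul_cancel₀ hm
  have h1 : v = (u ⨯₃ v) ⨯₃ P := by
    rw [cross_cross_eq_smul_sub_smul, huP, hv]; simp
  refine ⟨(u ⨯₃ v) ⬝ᵥ Y, -((u ⨯₃ v) ⬝ᵥ X), ?_⟩
  have h2 := cross_cross_eq_smul_sub_smul' (u ⨯₃ v) X Y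
  rw [dotProduct_comm X, ← hP, ← h1] at h2
  rw [neg_smul, ← sub_eq_add_neg, ← h2]

lemma mem_span_of_restrictLine_eq_zero {X Y : Fin 3 → k} (h : X ⨯₃ Y ≠ 0)
    {f : MvPolynomial (Fin 3) k} (hf : restrictLine (X ⨯₃ Y) f = 0) :
    f ∈ Ideal.span {linForm X, linForm Y} := by
  set I := Ideal.span {linForm X, linForm Y} with hI
  obtain ⟨m, hm⟩ := Function.ne_iff.1 h
  set P := X ⨯₃ Y with hP
  have hlin (v : Fin 3 → k) (hv : v ⬝ᵥ P = 0) : linForm v ∈ I := by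
    obtain ⟨a, b, rfl⟩ := exists_eq_smul_add_smul h hv
    rw [linForm_smul_add]
    exact Ideal.mem_span_pair.2 ⟨_, _, rfl⟩
  let ψ : Polynomial k →ₐ[k] MvPolynomial (Fin 3) k ⧸ I :=
    Polynomial.aeval (Ideal.Quotient.mkₐ k I (C (P m)⁻¹ * MvPolynomial.X m))
  have hψ : ψ.comp (restrictLine P) = Ideal.Quotient.mkₐ k I := by
    refine MvPolynomial.algHom_ext fun i => ?_
    have h1 := hlin ((-1 : k) • Pi.single i 1 + (P i * (P m)⁻¹) • Pi.single m 1) (by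
      have : P m ≠ 0 := hm
      simp [add_dotProduct, this])
    rw [linForm_smul_add, linForm_single, linForm_single] at h1
    have h2 : C (P i) * (C (P m)⁻¹ * MvPolynomial.X m) - MvPolynomial.X i ∈ I := by
      convert h1 using 1
      simp only [map_mul, map_neg, map_one]
      ring
    have h3 := (Ideal.Quotient.mk_eq_mk_iff_sub_mem _ _).2 h2
    rw [map_mul] at h3
    simp only [ψ, restrictLine, AlgHom.comp_apply, aeval_X, map_mul, Polynomial.aeval_C,
      Polynomial.aeval_X, Ideal.Quotient.mkₐ_eq_mk]
    rw [← h3, map_mul]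
    rfl
  rw [← Ideal.Quotient.eq_zero_iff_mem]
  have := DFunLike.congr_fun hψ f
  simpa [hf] using this.symm

lemma mem_span_linForm_prodForm {X : Fin 3 → k} {B : List (Fin 3 → k)}
    (hX : ∀ Y ∈ B, X ⨯₃ Y ≠ 0) (hB : B.Pairwise fun Y Y' => X ⬝ᵥ Y ⨯₃ Y' ≠ 0)
    {f : MvPolynomial (Fin 3) k} (hf : ∀ Y ∈ B, restrictLine (X ⨯₃ Y) f = 0) :
    f ∈ Ideal.span {linForm X, prodForm B} := by
  induction B with
  | nil => exact Ideal.mem_span_pair.2 ⟨0, f, by simp [prodForm]⟩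
  | cons Y B ih =>
    rw [List.pairwise_cons] at hB
    obtain ⟨a, b, hab⟩ := Ideal.mem_span_pair.1
      (ih (fun Z hZ => hX Z (by simp [hZ])) hB.2 fun Z hZ => hf Z (by simp [hZ]))
    have hb : restrictLine (X ⨯₃ Y) b = 0 := by
      have h1 := hf Y (by simp)
      rw [← hab] at h1
      simp only [map_add, map_mul, restrictLine_linForm, dot_self_cross, map_zero, zero_mul,
        mul_zero, zero_add, mul_eq_zero] at h1
      refine h1.resolve_right ?_
      rw [prodForm, map_list_prod]
      refine List.prod_ne_zero fun h0 => ?_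
      simp only [List.map_map, List.mem_map, Function.comp] at h0
      obtain ⟨Z, hZ, h0⟩ := h0
      rw [restrictLine_linForm] at h0
      refine hB.1 Z hZ ?_
      rw [triple_product_permutation, triple_product_permutation]
      simpa using h0
    obtain ⟨u, v, huv⟩ := Ideal.mem_span_pair.1
      (mem_span_of_restrictLine_eq_zero (hX Y (by simp)) hb)
    refine Ideal.mem_span_pair.2 ⟨a + u * prodForm B, v, ?_⟩
    rw [← hab, ← huv]
    simp [prodForm]
    ring

lemma mem_span_prodForm {A B : List (Fin 3 → k)} (hAB : ∀ X ∈ A, ∀ Y ∈ B, X ⨯₃ Y ≠ 0)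
    (hA : A.Pairwise fun X X' => ∀ Y ∈ B, Y ⬝ᵥ X ⨯₃ X' ≠ 0)
    (hB : B.Pairwise fun Y Y' => ∀ X ∈ A, X ⬝ᵥ Y ⨯₃ Y' ≠ 0)
    {f : MvPolynomial (Fin 3) k} (hf : ∀ X ∈ A, ∀ Y ∈ B, restrictLine (X ⨯₃ Y) f = 0) :
    f ∈ Ideal.span {prodForm A, prodForm B} := by
  induction A generalizing f with
  | nil => exact Ideal.mem_span_pair.2 ⟨f, 0, by simp [prodForm]⟩
  | cons X A ih =>
    rw [List.pairwise_cons] at hA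
    obtain ⟨a, b, hab⟩ := Ideal.mem_span_pair.1 (mem_span_linForm_prodForm (hAB X (by simp))
      (hB.imp fun h => h X (by simp)) (hf X (by simp)))
    have ha : ∀ X' ∈ A, ∀ Y ∈ B, restrictLine (X' ⨯₃ Y) a = 0 := by
      intro X' hX' Y hY
      have h1 := hf X' (by simp [hX']) Y hY
      have h2 : restrictLine (X' ⨯₃ Y) (prodForm B) = 0 := by
        rw [restrictLine_eq_zero_iff (isHomogeneous_prodForm B)]
        exact eval_prodForm_eq_zero hY (dot_cross_self _ _)
      rw [← hab, map_add, map_mul, map_mul, h2, mul_zero, add_zero, restrictLine_linForm] at h1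
      refine (mul_eq_zero.1 h1).resolve_right ?_
      have := hA.1 X' hX' Y hY
      rw [triple_product_permutation] at this
      simpa using this
    obtain ⟨u, v, huv⟩ := Ideal.mem_span_pair.1 (ih (fun X' h => hAB X' (by simp [h])) hA.2
      (hB.imp fun h X' hX' => h X' (by simp [hX'])) ha)
    refine Ideal.mem_span_pair.2 ⟨u, b + v * linForm X, ?_⟩
    rw [← hab, ← huv]
    simp [prodForm]
    ring

lemma cross_mem_pts_or {F : List (ι × (Fin 3 → k))} {i j : ι} (hij : i ≠ j) {X Y : Fin 3 → k}
    (hX : (i, X) ∈ F) (hY : (j, Y) ∈ F) : X ⨯₃ Y ∈ pts F ∨ Y ⨯₃ X ∈ pts F := by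
  induction F with
  | nil => simp at hX
  | cons x F ih =>
    obtain ⟨c, L⟩ := x
    simp only [pts, List.mem_append, List.mem_map, List.mem_filter, decide_eq_true_eq]
    rcases List.mem_cons.1 hX with h1 | h1 <;> rcases List.mem_cons.1 hY with h2 | h2
    · simp_all
    · obtain ⟨rfl, rfl⟩ := Prod.mk.inj h1
      exact Or.inl (Or.inl ⟨_, ⟨h2, hij.symm⟩, rfl⟩)
    · obtain ⟨rfl, rfl⟩ := Prod.mk.inj h2
      exact Or.inr (Or.inl ⟨_, ⟨h1, hij⟩, rfl⟩)
    · exact (ih h1 h2).imp Or.inr Or.inr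

lemma exists_of_mem_pts {F : List (ι × (Fin 3 → k))} {P : Fin 3 → k} (hP : P ∈ pts F) :
    ∃ x ∈ F, ∃ y ∈ F, x.1 ≠ y.1 ∧ P = x.2 ⨯₃ y.2 := by
  induction F with
  | nil => simp [pts] at hP
  | cons x F ih =>
    obtain ⟨c, L⟩ := x
    simp only [pts, List.mem_append, List.mem_map, List.mem_filter, decide_eq_true_eq] at hP
    rcases hP with ⟨y, ⟨hy, hyc⟩, rfl⟩ | hP
    · exact ⟨(c, L), by simp, y, by simp [hy], hyc.symm, rfl⟩
    · obtain ⟨x, hx, y, hy, h⟩ := ih hP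
      exact ⟨x, by simp [hx], y, by simp [hy], h⟩

lemma NonProp.neg_right {P Q : Fin 3 → k} (h : NonProp P (-Q)) : NonProp P Q := by
  unfold NonProp at *
  rwa [map_neg, neg_ne_zero] at h

lemma cross_cross_cross (X Y Z : Fin 3 → k) :
    (X ⨯₃ Y) ⨯₃ (X ⨯₃ Z) = (X ⬝ᵥ Y ⨯₃ Z) • X := by
  simp only [cross_apply, vec3_dotProduct]
  ext i
  fin_cases i <;> simp <;> ring

lemma pairwise_det_ne_zero {F : List (ι × (Fin 3 → k))} (h : (pts F).Pairwise NonProp) :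
    F.Pairwise fun x y => x.1 = y.1 → ∀ z ∈ F, z.1 ≠ x.1 → z.2 ⬝ᵥ x.2 ⨯₃ y.2 ≠ 0 := by
  induction F with
  | nil => simp
  | cons x F ih =>
    obtain ⟨c, L⟩ := x
    rw [pts, List.pairwise_append, List.pairwise_map, List.pairwise_filter] at h
    obtain ⟨h1, h2, h3⟩ := h
    refine List.pairwise_cons.2 ⟨fun y hy hcy z hz hzc => ?_, ?_⟩
    · have hz' : z ∈ F := by
        rcases List.mem_cons.1 hz with rfl | hz
        · simp at hzc
        · exact hz
      have key : NonProp (L ⨯₃ z.2) (y.2 ⨯₃ z.2) := by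
        have hm : L ⨯₃ z.2 ∈ (F.filter (·.1 ≠ c)).map (fun x => L ⨯₃ x.2) :=
          List.mem_map.2 ⟨z, by simpa [hz'] using hzc, rfl⟩
        rcases cross_mem_pts_or (F := F) (i := y.1) (j := z.1) (X := y.2) (Y := z.2)
          (by simpa [← hcy] using hzc.symm) hy hz' with h | h
        · exact h3 _ hm _ h
        · refine NonProp.neg_right ?_
          rw [cross_anticomm]
          exact h3 _ hm _ h
      intro h0
      refine key ?_
      rw [← cross_anticomm z.2, ← cross_anticomm z.2, map_neg, map_neg, LinearMap.neg_apply,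
        neg_neg, cross_cross_cross, h0, zero_smul]
    · refine (ih h2).imp₂ ?_ h1
      intro x y hxy hL hc z hz hzx
      rcases List.mem_cons.1 hz with rfl | hz
      · intro h0
        refine hL (by simpa using hzx.symm) (by simpa [← hc] using hzx.symm) ?_
        rw [cross_cross_cross, h0, zero_smul]
      · exact hxy hc z hz hzx

lemma length_pts [Fintype ι] (F : List (ι × (Fin 3 → k))) :
    2 * (pts F).length + ∑ i, (classLines F i).length ^ 2 = F.length ^ 2 := by
  induction F with
  | nil => simp [pts, classLines]
  | cons x F ih =>
    obtain ⟨c, L⟩ := x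
    have h1 : (F.filter (·.1 ≠ c)).length + (classLines F c).length = F.length := by
      rw [classLines, List.length_map, add_comm]
      simpa using (List.length_eq_length_filter_add (l := F) (fun x => decide (x.1 = c))).symm
    have h2 : ∑ i, (classLines ((c, L) :: F) i).length ^ 2 =
        ∑ i, (classLines F i).length ^ 2 + (2 * (classLines F c).length + 1) := by
      have (i : ι) : (classLines ((c, L) :: F) i).length ^ 2 = (classLines F i).length ^ 2 +
          if i = c then 2 * (classLines F c).length + 1 else 0 := by
        by_cases hi : i = c
        · subst hi
          simp [classLines]; ring
        · simp [classLines, hi, Ne.symm hi]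
      simp [this, Finset.sum_add_distrib]
    rw [h2]
    simp only [pts, List.length_append, List.length_map, List.length_cons]
    nlinarith

end Configurations

section Dimension

open Matrix

variable {k : Type*} [Field k] {r : ℕ}

lemma two_mul_Dval_add (d : Fin r → ℕ) : 2 * Dval d + ∑ i, d i ^ 2 = (∑ i, d i) ^ 2 := by
  have h : (∑ i, d i) ^ 2 = ∑ q : Fin r × Fin r, d q.1 * d q.2 := by
    rw [sq, Finset.sum_mul_sum, ← Finset.univ_product_univ, Finset.sum_product]
  have h1 : ∑ q ∈ univ.filter (fun q : Fin r × Fin r => q.2 < q.1), d q.1 * d q.2 = Dval d := by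
    refine Finset.sum_nbij' Prod.swap Prod.swap ?_ ?_ ?_ ?_ ?_ <;> simp [mul_comm]
  have h2 : ∑ q ∈ univ.filter (fun q : Fin r × Fin r => q.1 = q.2), d q.1 * d q.2 =
      ∑ i, d i ^ 2 := by
    refine Finset.sum_nbij' Prod.fst (fun i => (i, i)) ?_ ?_ ?_ ?_ ?_ <;> simp +contextual [sq]
  rw [h, ← Finset.sum_filter_add_sum_filter_not univ (fun q : Fin r × Fin r => q.1 < q.2),
    ← Finset.sum_filter_add_sum_filter_not (univ.filter fun q : Fin r × Fin r => ¬ q.1 < q.2)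
      (fun q : Fin r × Fin r => q.1 = q.2), Finset.filter_filter, Finset.filter_filter,
    Finset.filter_congr (p := fun q : Fin r × Fin r => ¬ q.1 < q.2 ∧ q.1 = q.2)
      (q := fun q : Fin r × Fin r => q.1 = q.2) (fun q _ => by grind),
    Finset.filter_congr (p := fun q : Fin r × Fin r => ¬ q.1 < q.2 ∧ ¬ q.1 = q.2)
      (q := fun q : Fin r × Fin r => q.2 < q.1) (fun q _ => by grind), h1, h2, Dval]
  ring

lemma mem_idealOfForms_iff {F : List (Fin r × (Fin 3 → k))} (h0 : ∀ P ∈ pts F, P ≠ 0)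
    (h : (pts F).Pairwise NonProp) {n : ℕ} {f : MvPolynomial (Fin 3) k} (hf : f.IsHomogeneous n) :
    f ∈ idealOfForms (fun i => prodForm (classLines F i)) ↔ ∀ P ∈ pts F, eval P f = 0 := by
  simp only [idealOfForms, Ideal.mem_iInf]
  constructor
  · intro hI P hP
    obtain ⟨⟨i, X⟩, hx, ⟨j, Y⟩, hy, hne, rfl⟩ := exists_of_mem_pts hP
    have key : ∀ i j : Fin r, i < j → ∀ X Y, (i, X) ∈ F → (j, Y) ∈ F → ∀ P, X ⬝ᵥ P = 0 →
        Y ⬝ᵥ P = 0 → eval P f = 0 := by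
      intro i j hij X Y hX hY P hXP hYP
      obtain ⟨a, b, rfl⟩ := Ideal.mem_span_pair.1 (hI i j hij)
      simp [eval_prodForm_eq_zero (mem_classLines.2 hX) hXP,
        eval_prodForm_eq_zero (mem_classLines.2 hY) hYP]
    rcases lt_or_gt_of_ne hne with hlt | hlt
    · exact key _ _ hlt _ _ hx hy _ (dot_self_cross _ _) (dot_cross_self _ _)
    · exact key _ _ hlt _ _ hy hx _ (dot_cross_self _ _) (dot_self_cross _ _)
  · intro hP i j hij
    have hdet := pairwise_det_ne_zero h
    have hc (i j : Fin r) (hij : i ≠ j) : (classLines F i).Pairwise fun X X' =>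
        ∀ Y ∈ classLines F j, Y ⬝ᵥ X ⨯₃ X' ≠ 0 := by
      rw [classLines.eq_def F i, List.pairwise_map, List.pairwise_filter]
      refine hdet.imp fun {x y} hxy hx hy Y hY => ?_
      simp only [decide_eq_true_eq] at hx hy
      exact hxy (hx.trans hy.symm) (j, Y) (mem_classLines.1 hY) (by simpa [hx] using hij.symm)
    refine mem_span_prodForm (fun X hX Y hY => ?_) (hc i j hij.ne) (hc j i hij.ne') ?_
    · rcases cross_mem_pts_or hij.ne (mem_classLines.1 hX) (mem_classLines.1 hY) with h | h
      · exact h0 _ h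
      · rw [← cross_anticomm, neg_ne_zero]
        exact h0 _ h
    · intro X hX Y hY
      rw [restrictLine_eq_zero_iff hf]
      rcases cross_mem_pts_or hij.ne (mem_classLines.1 hX) (mem_classLines.1 hY) with h | h
      · exact hP _ h
      · rw [← cross_anticomm, ← neg_one_smul k, eval_smul_of_isHomogeneous hf, hP _ h, mul_zero]

lemma sum_length_classLines {K : Type*} (F : List (Fin r × (Fin 3 → K))) :
    ∑ i, (classLines F i).length = F.length := by
  induction F with
  | nil => simp [classLines]
  | cons x F ih =>
    have (i : Fin r) : (classLines (x :: F) i).length = (classLines F i).length +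
        if i = x.1 then 1 else 0 := by
      by_cases hi : i = x.1
      · subst hi; simp [classLines]
      · simp [classLines, hi, Ne.symm hi]
    simp [this, Finset.sum_add_distrib, ih]

lemma length_pts_eq_Dval {F : List (Fin r × (Fin 3 → k))} {d : Fin r → ℕ}
    (hF : ∀ i, (classLines F i).length = d i) : (pts F).length = Dval d := by
  have h1 := length_pts F
  have h2 := two_mul_Dval_add d
  have h3 := sum_length_classLines F
  simp only [hF] at h1 h3
  rw [← h3] at h1
  omega

lemma gradedDim_add_two_mul_Dval {F G : List (Fin r × (Fin 3 → k))} {d : Fin r → ℕ}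
    (hF : ∀ i, (classLines F i).length = d i) (hG : ∀ i, (classLines G i).length = d i) {n : ℕ}
    (hn : n ≠ 0) (h : Indep n (pts F ++ pts G)) :
    gradedDim (idealOfForms (fun i => prodForm (classLines F i)) ⊓
      idealOfForms (fun i => prodForm (classLines G i))) n + 2 * Dval d = (n + 2).choose 2 := by
  have h0 := h.ne_zero hn
  have hp := List.pairwise_append.1 (h.pairwise_nonProp hn)
  have hI : (Submodule.restrictScalars k (idealOfForms (fun i => prodForm (classLines F i)) ⊓
      idealOfForms (fun i => prodForm (classLines G i))) ⊓ homogeneousSubmodule (Fin 3) k n) =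
      vanishing n (pts F ++ pts G) := by
    ext f
    simp only [Submodule.mem_inf, Submodule.restrictScalars_mem, mem_homogeneousSubmodule]
    have hF' := mem_idealOfForms_iff (fun P hP => h0 P (by simp [hP])) hp.1 (n := n) (f := f)
    have hG' := mem_idealOfForms_iff (fun P hP => h0 P (by simp [hP])) hp.2.1 (n := n) (f := f)
    constructor
    · rintro ⟨⟨h1, h2⟩, hf⟩
      refine ⟨hf, fun P hP => ?_⟩
      rcases List.mem_append.1 hP with hP | hP
      · exact (hF' hf).1 h1 P hP
      · exact (hG' hf).1 h2 P hP
    · rintro ⟨hf, h1⟩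
      exact ⟨⟨(hF' hf).2 fun P hP => h1 P (by simp [hP]),
        (hG' hf).2 fun P hP => h1 P (by simp [hP])⟩, hf⟩
  rw [gradedDim, hI, ← finrank_vanishing_add_length h, List.length_append,
    length_pts_eq_Dval hF, length_pts_eq_Dval hG, two_mul]

end Dimension

section Generic

open Matrix Filter

variable {k : Type*} [Field k]

lemma eventually_eval_ne_zero {p : Polynomial k} (hp : p ≠ 0) :
    ∀ᶠ t in cofinite, p.eval t ≠ 0 := by
  simpa [eventually_cofinite] using p.finite_setOfPred_isRoot hp

lemma eventually_forall_mem_list {α β : Type*} {f : Filter α} (l : List β) {q : β → α → Prop}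
    (h : ∀ b ∈ l, ∀ᶠ a in f, q b a) : ∀ᶠ a in f, ∀ b ∈ l, q b a :=
  (eventually_all_finite l.finite_toSet).2 h

lemma eventually_pairwise {α β : Type*} {f : Filter α} {l : List β} {q : β → β → α → Prop}
    (h : l.Pairwise fun b c => ∀ᶠ a in f, q b c a) :
    ∀ᶠ a in f, l.Pairwise fun b c => q b c a := by
  induction l with
  | nil => simp
  | cons b l ih =>
    simp only [List.pairwise_cons] at h ⊢
    exact (eventually_forall_mem_list l h.1).and (ih h.2)

/-- A line moving along a conic in the dual plane. -/
def conicLine (t : k) : Fin 3 → k := ![1, t, t ^ 2]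

lemma eventually_conicLine_dotProduct_ne_zero {v : Fin 3 → k} (hv : v ≠ 0) :
    ∀ᶠ t in cofinite, conicLine t ⬝ᵥ v ≠ 0 := by
  have hp : (Polynomial.C (v 0) + Polynomial.C (v 1) * Polynomial.X +
      Polynomial.C (v 2) * Polynomial.X ^ 2 : Polynomial k) ≠ 0 := by
    intro h
    have h' (n : ℕ) := congrArg (fun q => Polynomial.coeff q n) h
    refine hv (funext fun i => ?_)
    fin_cases i
    · simpa [Polynomial.coeff_X, Polynomial.coeff_X_pow, Polynomial.coeff_C] using h' 0
    · simpa [Polynomial.coeff_X, Polynomial.coeff_X_pow, Polynomial.coeff_C] using h' 1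
    · simpa [Polynomial.coeff_X, Polynomial.coeff_X_pow, Polynomial.coeff_C] using h' 2
  filter_upwards [eventually_eval_ne_zero hp] with t ht
  simp only [Polynomial.eval_add, Polynomial.eval_mul, Polynomial.eval_C, Polynomial.eval_X,
    Polynomial.eval_pow] at ht
  rw [vec3_dotProduct]
  simpa [conicLine, mul_comm] using ht

lemma eventually_conicLine_nonProp {X : Fin 3 → k} (hX : X ≠ 0) :
    ∀ᶠ t in cofinite, NonProp (conicLine t) X := by
  obtain ⟨v, hv, hvX⟩ : ∃ v : Fin 3 → k, v ≠ 0 ∧ v ⬝ᵥ X = 0 := by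
    by_contra! h
    have h0 : (![0, X 2, -X 1] : Fin 3 → k) = 0 := by
      by_contra h0
      exact h _ h0 (by rw [vec3_dotProduct]; simp; ring)
    have h1 : (![-X 2, 0, X 0] : Fin 3 → k) = 0 := by
      by_contra h1
      exact h _ h1 (by rw [vec3_dotProduct]; simp; ring)
    refine hX (funext fun i => ?_)
    fin_cases i
    · simpa using congrFun h1 2
    · simpa using congrFun h0 2
    · simpa using congrFun h0 1
  filter_upwards [eventually_conicLine_dotProduct_ne_zero hv] with t ht h
  obtain ⟨c, hc⟩ := exists_smul_of_cross_eq_zero hX h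
  rw [hc, smul_dotProduct, dotProduct_comm, hvX, smul_zero] at ht
  exact ht rfl

lemma Indep.eventually_append {n : ℕ} {Z S : List (Fin 3 → k)} (hZ : Indep n Z)
    (hZ0 : ∀ P ∈ Z, P ≠ 0) (hS : ∀ X ∈ S, X ≠ 0) (hS' : S.Pairwise NonProp)
    (hn : S.length ≤ n + 2) :
    ∀ᶠ t in cofinite, Indep (n + 1) (Z ++ S.map (conicLine t ⨯₃ ·)) := by
  have h1 := eventually_forall_mem_list Z fun P hP =>
    eventually_conicLine_dotProduct_ne_zero (hZ0 P hP)
  have h2 := eventually_forall_mem_list S fun X hX => eventually_conicLine_nonProp (hS X hX)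
  have h3 := eventually_pairwise (hS'.imp fun {X Y} (h : X ⨯₃ Y ≠ 0) =>
    eventually_conicLine_dotProduct_ne_zero h)
  filter_upwards [h1, h2, h3] with t h1 h2 h3
  refine hZ.peel (conicLine t) h1 ?_ (Indep.of_length_le ?_ ?_ ?_)
  · simp only [List.mem_map]
    rintro _ ⟨X, -, rfl⟩
    exact dot_self_cross _ _
  · simp only [List.mem_map]
    rintro _ ⟨X, hX, rfl⟩
    exact h2 X hX
  · rw [List.pairwise_map]
    refine h3.imp fun {X Y} h h0 => ?_
    rw [cross_cross_cross] at h0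
    rcases smul_eq_zero.1 h0 with h0 | h0
    · exact h h0
    · simpa [conicLine] using congrFun h0 0
  · simpa using hn

/-- The lines of an arrangement outside class `0`. -/
def otherLines {r : ℕ} [NeZero r] (F : List (Fin r × (Fin 3 → k))) : List (Fin 3 → k) :=
  (F.filter (·.1 ≠ 0)).map Prod.snd

variable (k) in
/-- There are two arrangements with `c i` lines in class `i` whose intersection points impose
independent conditions in degree `e`, the lines outside class `0` being distinct. -/
def HasConfig (r : ℕ) [NeZero r] (e : ℕ) (c : Fin r → ℕ) : Prop :=
  ∃ F G : List (Fin r × (Fin 3 → k)),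
    (∀ i, (classLines F i).length = c i) ∧ (∀ i, (classLines G i).length = c i) ∧
    (∀ L ∈ otherLines F ++ otherLines G, L ≠ 0) ∧
    (otherLines F ++ otherLines G).Pairwise NonProp ∧ Indep e (pts F ++ pts G)

lemma length_otherLines {K : Type*} {r : ℕ} [NeZero r] {F : List (Fin r × (Fin 3 → K))}
    {c : Fin r → ℕ}
    (hF : ∀ i, (classLines F i).length = c i) :
    (otherLines F).length + c 0 = ∑ i, c i := by
  have h1 := sum_length_classLines F
  simp only [hF] at h1
  rw [h1, ← hF 0, otherLines, classLines, List.length_map, List.length_map, add_comm]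
  simpa using (List.length_eq_length_filter_add (l := F) (fun x => decide (x.1 = 0))).symm

lemma pts_cons_zero {r : ℕ} [NeZero r] (L : Fin 3 → k) (F : List (Fin r × (Fin 3 → k))) :
    pts ((0, L) :: F) = (otherLines F).map (L ⨯₃ ·) ++ pts F := by
  simp [pts, otherLines, Function.comp_def]

lemma HasConfig.step [Infinite k] {r : ℕ} [NeZero r] {e : ℕ} {c : Fin r → ℕ}
    (h : HasConfig k r e c) (he : e ≠ 0) (hc : 2 * ∑ i, c i ≤ e + 2 + 2 * c 0) :
    HasConfig k r (e + 1) (Function.update c 0 (c 0 + 1)) := by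
  obtain ⟨F, G, hF, hG, h0, hp, hI⟩ := h
  have hlF := length_otherLines hF
  have hlG := length_otherLines hG
  obtain ⟨t, ht⟩ := (hI.eventually_append (hI.ne_zero he) h0 hp
    (by rw [List.length_append]; omega)).exists
  have hcount (F : List (Fin r × (Fin 3 → k))) (hF : ∀ i, (classLines F i).length = c i)
      (i : Fin r) : (classLines ((0, conicLine t) :: F) i).length =
        Function.update c 0 (c 0 + 1) i := by
    by_cases hi : i = 0
    · subst hi; simpa [classLines] using hF 0
    · simpa [classLines, hi, Ne.symm hi] using hF i
  refine ⟨(0, conicLine t) :: F, (0, conicLine t) :: G, hcount F hF, hcount G hG,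
    by simpa [otherLines] using h0, by simpa [otherLines] using hp, ht.perm ?_⟩
  rw [pts_cons_zero, pts_cons_zero, List.map_append, ← Multiset.coe_eq_coe]
  simp only [← Multiset.coe_add]
  abel

lemma HasConfig.steps [Infinite k] {r : ℕ} [NeZero r] {e : ℕ} {c : Fin r → ℕ}
    (h : HasConfig k r e c) (he : e ≠ 0) (hc : 2 * ∑ i, c i ≤ e + 2 + 2 * c 0) (n : ℕ) :
    HasConfig k r (e + n) (Function.update c 0 (c 0 + n)) := by
  induction n with
  | zero => simpa using h
  | succ n ih =>
    have := ih.step (by omega) ?_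
    · simpa [add_assoc] using this
    · have h1 := Finset.add_sum_erase univ (Function.update c 0 (c 0 + n)) (mem_univ 0)
      have h2 := Finset.add_sum_erase univ c (mem_univ 0)
      rw [Finset.sum_congr rfl (g := c) fun i hi => by
        simp [Function.update_of_ne (Finset.ne_of_mem_erase hi)]] at h1
      have h3 : ∑ i ∈ univ.erase 0, c i = (univ.erase 0).sum c := rfl
      simp only [Function.update_self] at h1 ⊢
      omega

lemma HasConfig.exists_forms {r : ℕ} [NeZero r] (hr : 2 ≤ r) {e : ℕ} {c : Fin r → ℕ}
    (h : HasConfig k r e c) (he : e ≠ 0) (hc : ∀ i, 1 ≤ c i) :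
    ∃ F G : Fin r → MvPolynomial (Fin 3) k,
      (∀ i, F i ≠ 0 ∧ (F i).IsHomogeneous (c i)) ∧
      (∀ i, G i ≠ 0 ∧ (G i).IsHomogeneous (c i)) ∧
      gradedDim (idealOfForms F ⊓ idealOfForms G) e + 2 * Dval c = (e + 2).choose 2 := by
  obtain ⟨F, G, hF, hG, -, -, hI⟩ := h
  have h0 := hI.ne_zero he
  have key (F : List (Fin r × (Fin 3 → k))) (hF : ∀ i, (classLines F i).length = c i)
      (h0 : ∀ P ∈ pts F, P ≠ 0) (i : Fin r) :
      prodForm (classLines F i) ≠ 0 ∧ (prodForm (classLines F i)).IsHomogeneous (c i) := by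
    refine ⟨prodForm_ne_zero fun L hL => ?_, hF i ▸ isHomogeneous_prodForm _⟩
    rintro rfl
    have : Nontrivial (Fin r) := Fin.nontrivial_iff_two_le.2 hr
    obtain ⟨j, hj⟩ := exists_ne i
    obtain ⟨M, hM⟩ := List.exists_mem_of_length_pos (l := classLines F j) (by
      rw [hF]; exact hc j)
    rcases cross_mem_pts_or hj (mem_classLines.1 hM) (mem_classLines.1 hL) with h | h
    · exact h0 _ h (by simp)
    · exact h0 _ h (by simp)
  exact ⟨_, _, key F hF fun P hP => h0 P (by simp [hP]), key G hG fun P hP => h0 P (by simp [hP]),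
    gradedDim_add_two_mul_Dval hF hG he hI⟩

end Generic

section IntPolynomials

/-- Sum of integer polynomials given by coefficient lists. -/
def zadd : List ℤ → List ℤ → List ℤ
  | [], q => q
  | a :: p, [] => a :: p
  | a :: p, b :: q => (a + b) :: zadd p q

/-- Product of integer polynomials given by coefficient lists. -/
def zmul : List ℤ → List ℤ → List ℤ
  | [], _ => []
  | a :: p, q => zadd (q.map (a * ·)) (0 :: zmul p q)

/-- The value at `t` of the polynomial with coefficient list `p`. -/
def zeval {R : Type*} [CommRing R] (t : R) : List ℤ → R
  | [] => 0
  | a :: p => a + t * zeval t p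

/-- The sum of the absolute values of the coefficients. -/
def znorm : List ℤ → ℕ
  | [] => 0
  | a :: p => a.natAbs + znorm p

/-- The greatest common divisor of the coefficients. -/
def zcontent : List ℤ → ℕ
  | [] => 0
  | a :: p => Nat.gcd a.natAbs (zcontent p)

lemma zeval_zadd {R : Type*} [CommRing R] (t : R) (p q : List ℤ) :
    zeval t (zadd p q) = zeval t p + zeval t q := by
  induction p generalizing q with
  | nil => simp [zadd, zeval]
  | cons a p ih =>
    cases q with
    | nil => simp [zadd, zeval]
    | cons b q => simp [zadd, zeval, ih]; ring

lemma zeval_map_mul {R : Type*} [CommRing R] (t : R) (a : ℤ) (p : List ℤ) :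
    zeval t (p.map (a * ·)) = a * zeval t p := by
  induction p with
  | nil => simp [zeval]
  | cons b p ih => simp [zeval, ih]; ring

lemma zeval_zmul {R : Type*} [CommRing R] (t : R) (p q : List ℤ) :
    zeval t (zmul p q) = zeval t p * zeval t q := by
  induction p with
  | nil => simp [zmul, zeval]
  | cons a p ih => simp [zmul, zeval, zeval_zadd, zeval_map_mul, ih]; ring

lemma znorm_zadd_le (p q : List ℤ) : znorm (zadd p q) ≤ znorm p + znorm q := by
  induction p generalizing q with
  | nil => simp [zadd, znorm]
  | cons a p ih =>
    cases q with
    | nil => simp [zadd, znorm]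
    | cons b q =>
      have h1 := ih q
      have h2 := Int.natAbs_add_le a b
      simp only [zadd, znorm]
      omega

lemma znorm_map_mul (a : ℤ) (p : List ℤ) : znorm (p.map (a * ·)) = a.natAbs * znorm p := by
  induction p with
  | nil => simp [znorm]
  | cons b p ih => simp [znorm, ih, Int.natAbs_mul, mul_add]

lemma znorm_zmul_le (p q : List ℤ) : znorm (zmul p q) ≤ znorm p * znorm q := by
  induction p with
  | nil => simp [zmul, znorm]
  | cons a p ih =>
    refine (znorm_zadd_le _ _).trans ?_
    simp only [znorm_map_mul, znorm, add_mul, Int.natAbs_zero, zero_add]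
    omega

/-- The point at which integer polynomials are evaluated in order to compute with them. -/
def zbase : ℕ := 1208925819614629174706176

/-- Half of `zbase`. -/
def zhalf : ℕ := 604462909807314587353088

/-- An integer polynomial together with its value at `zbase`, as a difference of natural numbers,
and a bound for its coefficients; these determine it when the bound is small. -/
structure KPoly where
  /-- the coefficients -/
  poly : List ℤ
  /-- the positive part of the value at `zbase` -/
  pos : ℕ
  /-- the negative part of the value at `zbase` -/
  neg : ℕ
  /-- a bound for the coefficients -/
  bound : ℕ
  val_eq : (pos : ℤ) - neg = zeval (zbase : ℤ) poly
  norm_le : znorm poly ≤ bound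

namespace KPoly

/-- The polynomial with a given coefficient list. -/
def ofList (p : List ℤ) : KPoly where
  poly := p
  pos := (zeval (zbase : ℤ) p).toNat
  neg := (-zeval (zbase : ℤ) p).toNat
  bound := znorm p
  val_eq := Int.toNat_sub_toNat_neg _
  norm_le := le_rfl

/-- Sum. -/
def add (x y : KPoly) : KPoly where
  poly := zadd x.poly y.poly
  pos := Nat.add x.pos y.pos
  neg := Nat.add x.neg y.neg
  bound := Nat.add x.bound y.bound
  val_eq := by
    rw [zeval_zadd, ← x.val_eq, ← y.val_eq]
    simp only [Nat.add_eq]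
    push_cast
    ring
  norm_le := (znorm_zadd_le _ _).trans (Nat.add_le_add x.norm_le y.norm_le)

/-- Product. -/
def mul (x y : KPoly) : KPoly where
  poly := zmul x.poly y.poly
  pos := Nat.add (Nat.mul x.pos y.pos) (Nat.mul x.neg y.neg)
  neg := Nat.add (Nat.mul x.pos y.neg) (Nat.mul x.neg y.pos)
  bound := Nat.mul x.bound y.bound
  val_eq := by
    rw [zeval_zmul, ← x.val_eq, ← y.val_eq]
    simp only [Nat.add_eq, Nat.mul_eq]
    push_cast
    ring
  norm_le := (znorm_zmul_le _ _).trans (Nat.mul_le_mul x.norm_le y.norm_le)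

/-- Difference. -/
def sub (x y : KPoly) : KPoly where
  poly := zadd x.poly (y.poly.map (-1 * ·))
  pos := Nat.add x.pos y.neg
  neg := Nat.add x.neg y.pos
  bound := Nat.add x.bound y.bound
  val_eq := by
    rw [zeval_zadd, zeval_map_mul, ← x.val_eq, ← y.val_eq]
    simp only [Nat.add_eq]
    push_cast
    ring
  norm_le := (znorm_zadd_le _ _).trans (Nat.add_le_add x.norm_le (by
    rw [znorm_map_mul]; simpa using y.norm_le))

/-- The polynomial vanishes. -/
def isZero (x : KPoly) : Bool := Nat.beq x.pos x.neg && Nat.ble x.bound zhalf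

/-- The balanced digits of `v` in base `zbase` have no common divisor with `g`. -/
def coprimeDigits : ℕ → ℕ → ℕ → Bool
  | 0, g, _ => Nat.beq g 1
  | n + 1, g, v => Nat.beq g 1 || (!Nat.beq v 0 && coprimeDigits n
      (Nat.gcd g (Nat.add (Nat.sub (Nat.mod (Nat.add v zhalf) zbase) zhalf)
        (Nat.sub zhalf (Nat.mod (Nat.add v zhalf) zbase))))
      (Nat.div (Nat.add v zhalf) zbase))

/-- The coefficients have no common divisor. -/
def isPrim (x : KPoly) : Bool :=
  Nat.ble (Nat.succ x.bound) zhalf &&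
    coprimeDigits 70 0 (Nat.add (Nat.sub x.pos x.neg) (Nat.sub x.neg x.pos))

end KPoly

/-- Vectors with polynomial coordinates. -/
abbrev KVec := KPoly × KPoly × KPoly

namespace KVec

/-- Vectors with given coordinates. -/
def ofList (a b c : List ℤ) : KVec := (KPoly.ofList a, KPoly.ofList b, KPoly.ofList c)

/-- Cross product. -/
def cross (x y : KVec) : KVec :=
  (.sub (.mul x.2.1 y.2.2) (.mul x.2.2 y.2.1), .sub (.mul x.2.2 y.1) (.mul x.1 y.2.2),
    .sub (.mul x.1 y.2.1) (.mul x.2.1 y.1))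

/-- Scalar product. -/
def dot (x y : KVec) : KPoly :=
  .add (.mul x.1 y.1) (.add (.mul x.2.1 y.2.1) (.mul x.2.2 y.2.2))

/-- Some coordinate is primitive. -/
def isPrim (x : KVec) : Bool := x.1.isPrim || (x.2.1.isPrim || x.2.2.isPrim)

end KVec

/-- The vectors in a list are pairwise nonproportional. -/
def pairwisePrim : List KVec → Bool
  | [] => true
  | P :: l => l.all (fun Q => (KVec.cross P Q).isPrim) && pairwisePrim l

/-- The intersection points of an arrangement with polynomial coordinates. -/
def kpts : List (ℕ × KVec) → List KVec
  | [] => []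
  | (c, L) :: F => (F.filter (fun x => !Nat.beq x.1 c)).map (fun x => L.cross x.2) ++ kpts F

/-- The points of `Z` on the lines `ls`, which are removed one at a time, impose independent
conditions, and they exhaust `Z`. -/
def peelCheck : ℕ → List KVec → List KVec → Bool
  | _, Z, [] => Z.isEmpty
  | e, Z, L :: ls =>
    let on := Z.filter fun P => (L.dot P).isZero
    let off := Z.filter fun P => !(L.dot P).isZero
    Nat.ble on.length (e + 1) && (on.all KVec.isPrim && (pairwisePrim on &&
      (off.all (fun P => (L.dot P).isPrim) &&
        match e with
        | 0 => off.isEmpty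
        | e + 1 => peelCheck e off ls)))

end IntPolynomials

section Soundness

open Matrix Filter

lemma zeval_eq_zero_of_forall {R : Type*} [CommRing R] (t : R) {p : List ℤ}
    (h : ∀ a ∈ p, a = 0) : zeval t p = 0 := by
  induction p with
  | nil => rfl
  | cons a p ih =>
    simp only [List.mem_cons, forall_eq_or_imp] at h
    simp [zeval, h.1, ih h.2]

lemma forall_eq_zero_of_zeval_eq_zero {b : ℤ} {p : List ℤ} (hp : (znorm p : ℤ) < b)
    (h : zeval b p = 0) : ∀ a ∈ p, a = 0 := by
  induction p with
  | nil => simp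
  | cons a p ih =>
    simp only [znorm, Nat.cast_add] at hp
    simp only [zeval, Int.cast_id] at h
    have ha : a = 0 := by
      refine Int.eq_zero_of_abs_lt_dvd (m := b) ⟨-zeval b p, by linarith⟩ ?_
      rw [Int.abs_eq_natAbs]
      omega
    subst ha
    have hb : b ≠ 0 := by omega
    simp only [List.mem_cons, forall_eq_or_imp, true_and]
    exact ih (by simpa using hp) (by simpa [hb] using h)

lemma KPoly.isZero_sound {R : Type*} [CommRing R] (t : R) {x : KPoly} (h : x.isZero = true) :
    zeval t x.poly = 0 := by
  simp only [KPoly.isZero, Bool.and_eq_true, Nat.beq_eq, Nat.ble_eq] at h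
  refine zeval_eq_zero_of_forall t (forall_eq_zero_of_zeval_eq_zero (b := zbase) ?_ ?_)
  · have := x.norm_le
    have := h.2
    simp only [zhalf, zbase] at *
    omega
  · rw [← x.val_eq, h.1, sub_self]

lemma dvd_zcontent {p : List ℤ} {n : ℕ} (h : ∀ a ∈ p, (n : ℤ) ∣ a) : n ∣ zcontent p := by
  induction p with
  | nil => simp [zcontent]
  | cons b p ih =>
    simp only [List.mem_cons, forall_eq_or_imp] at h
    exact Nat.dvd_gcd (Int.natCast_dvd.1 h.1) (ih h.2)

lemma digit_of_natAbs {a w : ℤ} {v : ℕ} (ha : a.natAbs < zhalf)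
    (hv : v = (a + zbase * w).natAbs) :
    ((v + zhalf) % zbase - zhalf) + (zhalf - (v + zhalf) % zbase) = a.natAbs ∧
      (v + zhalf) / zbase = w.natAbs := by
  simp only [zhalf, zbase] at *
  omega

lemma coprimeDigits_sound {n g v : ℕ} {p : List ℤ} (hp : znorm p < zhalf)
    (hv : v = (zeval (zbase : ℤ) p).natAbs) (h : KPoly.coprimeDigits n g v = true) :
    Nat.gcd g (zcontent p) = 1 := by
  induction n generalizing g v p with
  | zero =>
    simp only [KPoly.coprimeDigits, Nat.beq_eq] at h
    simp [h]
  | succ n ih =>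
    simp only [KPoly.coprimeDigits, Bool.or_eq_true, Nat.beq_eq, Bool.and_eq_true] at h
    rcases h with h | ⟨h0, h⟩
    · simp [h]
    cases p with
    | nil =>
      simp only [zeval, Int.natAbs_zero] at hv
      subst hv
      exact absurd h0 (by decide)
    | cons a p =>
      simp only [znorm] at hp
      obtain ⟨h1, h2⟩ := digit_of_natAbs (v := v) (a := a) (w := zeval (zbase : ℤ) p) (by omega)
        (by simpa [zeval] using hv)
      have := ih (p := p) (by omega) h2 h
      simp only [Nat.add_eq, Nat.sub_eq, HMod.hMod, Mod.mod] at this h1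
      simp only [zcontent]
      rw [← Nat.gcd_assoc, ← h1]
      exact this

lemma KPoly.isPrim_sound {x : KPoly} (h : x.isPrim = true) : zcontent x.poly = 1 := by
  simp only [KPoly.isPrim, Bool.and_eq_true, Nat.ble_eq] at h
  have h1 := x.norm_le
  have h2 := x.val_eq
  have := coprimeDigits_sound (p := x.poly) (by omega) (by
    rw [← h2]; simp only [Nat.add_eq, Nat.sub_eq]; omega) h.2
  simpa using this

variable {k : Type*} [Field k]

lemma eventually_zeval_ne_zero {p : List ℤ} (h : zcontent p = 1) :
    ∀ᶠ t : k in cofinite, zeval t p ≠ 0 := by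
  obtain ⟨f, hf, h0⟩ : ∃ f : Polynomial k, (∀ t, f.eval t = zeval t p) ∧
      (f = 0 → ∀ a ∈ p, ((a : ℤ) : k) = 0) := by
    clear h
    induction p with
    | nil => exact ⟨0, by simp [zeval], by simp⟩
    | cons a p ih =>
      obtain ⟨f, hf, h0⟩ := ih
      refine ⟨Polynomial.C (a : k) + Polynomial.X * f, by simp [zeval, hf], fun h => ?_⟩
      have ha : (a : k) = 0 := by simpa using congrArg (Polynomial.coeff · 0) h
      simp only [List.mem_cons, forall_eq_or_imp]
      refine ⟨ha, h0 ?_⟩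
      simpa [ha] using h
  have hf0 : f ≠ 0 := by
    intro hf0
    have h1 : ringChar k ∣ zcontent p := dvd_zcontent fun a ha =>
      (CharP.intCast_eq_zero_iff k (ringChar k) a).1 (h0 hf0 a ha)
    rw [h, Nat.dvd_one] at h1
    exact CharP.ringChar_ne_one h1
  simpa only [hf] using eventually_eval_ne_zero hf0

/-- The value of a vector of polynomials. -/
def evalVec (t : k) (x : KVec) : Fin 3 → k :=
  ![zeval t x.1.poly, zeval t x.2.1.poly, zeval t x.2.2.poly]

lemma zeval_sub (t : k) (x y : KPoly) :
    zeval t (x.sub y).poly = zeval t x.poly - zeval t y.poly := by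
  rw [KPoly.sub, zeval_zadd, zeval_map_mul]
  push_cast
  ring

lemma evalVec_cross (t : k) (x y : KVec) :
    evalVec t (x.cross y) = evalVec t x ⨯₃ evalVec t y := by
  simp [evalVec, KVec.cross, cross_apply, zeval_sub, KPoly.mul, zeval_zmul]

lemma zeval_dot (t : k) (x y : KVec) :
    zeval t (x.dot y).poly = evalVec t x ⬝ᵥ evalVec t y := by
  simp [evalVec, KVec.dot, KPoly.add, KPoly.mul, zeval_zadd, zeval_zmul, add_assoc]

lemma eventually_evalVec_ne_zero {x : KVec} (h : x.isPrim = true) :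
    ∀ᶠ t : k in cofinite, evalVec t x ≠ 0 := by
  simp only [KVec.isPrim, Bool.or_eq_true] at h
  rcases h with h | h | h
  · filter_upwards [eventually_zeval_ne_zero (KPoly.isPrim_sound h)] with t ht h0
    exact ht (by simpa [evalVec] using congrFun h0 0)
  · filter_upwards [eventually_zeval_ne_zero (KPoly.isPrim_sound h)] with t ht h0
    exact ht (by simpa [evalVec] using congrFun h0 1)
  · filter_upwards [eventually_zeval_ne_zero (KPoly.isPrim_sound h)] with t ht h0
    exact ht (by simpa [evalVec] using congrFun h0 2)

lemma eventually_evalVec_pairwise {l : List KVec} (h : pairwisePrim l = true) :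
    ∀ᶠ t : k in cofinite, (l.map (evalVec t)).Pairwise NonProp := by
  simp only [List.pairwise_map]
  refine eventually_pairwise ?_
  induction l with
  | nil => simp
  | cons P l ih =>
    simp only [pairwisePrim, Bool.and_eq_true, List.all_eq_true] at h
    refine List.pairwise_cons.2 ⟨fun Q hQ => ?_, ih h.2⟩
    filter_upwards [eventually_evalVec_ne_zero (h.1 Q hQ)] with t ht
    rwa [evalVec_cross] at ht

lemma eventually_indep_of_peelCheck {e : ℕ} {Z ls : List KVec} (h : peelCheck e Z ls = true) :
    ∀ᶠ t : k in cofinite, Indep e (Z.map (evalVec t)) := by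
  induction ls generalizing e Z with
  | nil =>
    simp only [peelCheck, List.isEmpty_iff] at h
    simp [h, Indep]
  | cons L ls ih =>
    rw [peelCheck.eq_def] at h
    simp only [Bool.and_eq_true, Nat.ble_eq, List.all_eq_true] at h
    obtain ⟨hlen, hprim, hpair, hoff, h⟩ := h
    have hon : ∀ P ∈ Z.filter fun P => (L.dot P).isZero, (L.dot P).isZero = true :=
      fun P hP => (List.mem_filter.1 hP).2
    have hperm := List.filter_append_perm (fun P => (L.dot P).isZero) Z
    generalize (Z.filter fun P => (L.dot P).isZero) = on at *
    generalize (Z.filter fun P => !(L.dot P).isZero) = off at *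
    have h1 := eventually_forall_mem_list on fun P hP =>
      eventually_evalVec_ne_zero (k := k) (hprim P hP)
    have h2 := eventually_forall_mem_list off fun P hP =>
      eventually_zeval_ne_zero (k := k) (KPoly.isPrim_sound (hoff P hP))
    have h3 := eventually_evalVec_pairwise (k := k) hpair
    have hindep {t : k} (h1 : ∀ P ∈ on, evalVec t P ≠ 0)
        (h3 : (on.map (evalVec t)).Pairwise NonProp) : Indep e (on.map (evalVec t)) :=
      Indep.of_length_le (List.forall_mem_map.2 h1) h3 (by simpa using hlen)
    cases e with
    | zero =>
      simp only [List.isEmpty_iff] at h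
      filter_upwards [h1, h3] with t h1 h3
      refine (hindep h1 h3).perm (List.Perm.map _ ?_)
      simpa [h] using hperm
    | succ e =>
      filter_upwards [h1, h2, h3, ih h] with t h1 h2 h3 h4
      refine (h4.peel (evalVec t L) ?_ ?_ (hindep h1 h3)).perm ?_
      · exact List.forall_mem_map.2 fun P hP => zeval_dot t L P ▸ h2 P hP
      · exact List.forall_mem_map.2 fun P hP =>
          zeval_dot t L P ▸ KPoly.isZero_sound t (hon P hP)
      · rw [← List.map_append]
        exact (List.perm_append_comm.trans hperm).map _

/-- The number of lines of class `i`. -/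
def countClass (F : List (ℕ × KVec)) (i : ℕ) : ℕ := (F.filter fun x => Nat.beq x.1 i).length

/-- The lines outside class `0`. -/
def others (F : List (ℕ × KVec)) : List KVec := (F.filter fun x => !Nat.beq x.1 0).map Prod.snd

/-- A certificate, by successive removal of the lines `ls`, for the existence of two arrangements
whose points of intersection impose independent conditions in degree `e`. -/
def certificate (r e : ℕ) (F G : List (ℕ × KVec)) (ls : List KVec) : Bool :=
  (F.all fun x => Nat.ble (x.1 + 1) r) && ((G.all fun x => Nat.ble (x.1 + 1) r) &&
    (((List.range r).all fun i => Nat.beq (countClass F i) (countClass G i)) &&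
      ((others F ++ others G).all KVec.isPrim && (pairwisePrim (others F ++ others G) &&
        peelCheck e (kpts F ++ kpts G) ls))))

/-- The arrangement of lines obtained by evaluation. -/
def evalLines (r : ℕ) [NeZero r] (t : k) (F : List (ℕ × KVec)) : List (Fin r × (Fin 3 → k)) :=
  F.map fun x => (Fin.ofNat r x.1, evalVec t x.2)

variable {r : ℕ} [NeZero r]

lemma ofNat_eq_iff {m n : ℕ} (hm : m < r) (hn : n < r) :
    Fin.ofNat r m = Fin.ofNat r n ↔ m = n := by
  simp [Fin.ext_iff, Nat.mod_eq_of_lt hm, Nat.mod_eq_of_lt hn]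

lemma pts_evalLines {t : k} {F : List (ℕ × KVec)} (hF : ∀ x ∈ F, x.1 < r) :
    pts (evalLines r t F) = (kpts F).map (evalVec t) := by
  induction F with
  | nil => rfl
  | cons x F ih =>
    obtain ⟨c, L⟩ := x
    simp only [List.mem_cons, forall_eq_or_imp] at hF
    have := ih hF.2
    simp only [evalLines] at this
    simp only [evalLines, List.map_cons, pts, kpts, List.map_append, this, List.filter_map,
      List.map_map]
    congr 1
    have h : F.filter ((fun x : Fin r × (Fin 3 → k) => decide (x.1 ≠ Fin.ofNat r c)) ∘
        fun x => (Fin.ofNat r x.1, evalVec t x.2)) = F.filter fun x => !Nat.beq x.1 c := by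
      refine List.filter_congr fun x hx => ?_
      rw [Bool.eq_iff_iff]
      rw [Function.comp_apply, decide_eq_true_iff, Ne, ofNat_eq_iff (hF.2 x hx) hF.1,
        Bool.not_eq_true', ← Bool.not_eq_true, Nat.beq_eq]
    rw [h]
    exact List.map_congr_left fun x _ => (evalVec_cross t L x.2).symm

lemma length_classLines_evalLines {t : k} {F : List (ℕ × KVec)} (hF : ∀ x ∈ F, x.1 < r)
    (i : Fin r) : (classLines (evalLines r t F) i).length = countClass F i := by
  rw [classLines, List.length_map, evalLines, List.filter_map, List.length_map, countClass]
  congr 1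
  refine List.filter_congr fun x hx => ?_
  rw [Bool.eq_iff_iff]
  simp [Fin.ext_iff, Nat.mod_eq_of_lt (hF x hx)]

lemma otherLines_evalLines {t : k} {F : List (ℕ × KVec)} (hF : ∀ x ∈ F, x.1 < r) :
    otherLines (evalLines r t F) = (others F).map (evalVec t) := by
  rw [otherLines, evalLines, List.filter_map, List.map_map, others, List.map_map]
  congr 1
  refine List.filter_congr fun x hx => ?_
  rw [Bool.eq_iff_iff]
  rw [Function.comp_apply, decide_eq_true_iff, Ne, show (0 : Fin r) = Fin.ofNat r 0 from rfl,
    ofNat_eq_iff (hF x hx) (NeZero.pos r), Bool.not_eq_true', ← Bool.not_eq_true, Nat.beq_eq]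

lemma HasConfig.of_certificate [Infinite k] {e : ℕ} {F G : List (ℕ × KVec)} {ls : List KVec}
    (h : certificate r e F G ls = true) : HasConfig k r e fun i => countClass F i := by
  simp only [certificate, Bool.and_eq_true, List.all_eq_true, Nat.ble_eq, Nat.beq_eq,
    List.mem_range] at h
  obtain ⟨hF, hG, hFG, h0, hp, hI⟩ := h
  obtain ⟨t, h0, hp, hI⟩ := ((eventually_forall_mem_list _ fun P hP =>
    eventually_evalVec_ne_zero (k := k) (h0 P hP)).and
      ((eventually_evalVec_pairwise hp).and (eventually_indep_of_peelCheck hI))).exists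
  refine ⟨evalLines r t F, evalLines r t G, length_classLines_evalLines hF, fun i => ?_, ?_, ?_, ?_⟩
  · exact (length_classLines_evalLines hG i).trans (hFG i i.2).symm
  · rw [otherLines_evalLines hF, otherLines_evalLines hG, ← List.map_append]
    exact List.forall_mem_map.2 h0
  · rwa [otherLines_evalLines hF, otherLines_evalLines hG, ← List.map_append]
  · rwa [pts_evalLines hF, pts_evalLines hG, ← List.map_append]

end Soundness

section Certificates

open KVec

/-- The list of coefficients of `a + b t ^ n`. -/
def addMonomial (a b : List ℤ) (n : ℕ) : List ℤ := zadd a (List.replicate n 0 ++ b)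

/-- Lines in a pencil, one for each power of the parameter. -/
def pencilA (i : ℕ) : KVec := ofList [1] [] (List.replicate i 0 ++ [-1])

/-- Lines in a second pencil. -/
def pencilB (i : ℕ) : KVec := ofList [] [1] (List.replicate i 0 ++ [-1])

/-- Lines in a third pencil. -/
def pencilC (m : ℕ) : KVec := ofList (List.replicate (if m < 5 then m else 7) 0 ++ [1]) [-1] []

/-- Lines through the points of intersection of `C` with the lines of the third pencil. -/
def pencilD (C C' : List ℤ × List ℤ × List ℤ) (n m : ℕ) : KVec :=
  if m = 5 then ofList [1] [] [1, -1, 0, 1]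
  else if m < n then ofList (addMonomial C.1 C.2.1 m) [] C.2.2
  else ofList (addMonomial C'.1 C'.2.1 m) [] C'.2.2

/-- The coordinates of a special line. -/
def line₁ : List ℤ × List ℤ × List ℤ := ([1, 1, 1, 0, 1], [1], [1, 1, -1, 1])

/-- The coordinates of a special line. -/
def line₂ : List ℤ × List ℤ × List ℤ := ([1, 1], [0, 0, 1, 1], [1])

/-- The coordinates of a special line. -/
def line₃ : List ℤ × List ℤ × List ℤ := ([-1, 0, 1, 1], [1, 1, 0, 1, 1], [-1, 1])

/-- The coordinates of a special line. -/
def line₄ : List ℤ × List ℤ × List ℤ := ([-1, -1, -1, 1, 1], [-1, 0, 1, 0, 1], [0, 0, 0, 1, 1])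

/-- The vector with given coordinates. -/
def toVec (C : List ℤ × List ℤ × List ℤ) : KVec := ofList C.1 C.2.1 C.2.2

/-- Lines with a common label. -/
def label (c : ℕ) (l : List KVec) : List (ℕ × KVec) := l.map fun L => (c, L)

/-- The lines used to verify an arrangement built from pencils. -/
def peelLines (a : ℕ) (l : List KVec) : List KVec :=
  l ++ (List.range a).map pencilC ++ ((List.range a).map pencilA).reverse

/-- Certificate for the class sizes `a, a, 2`. -/
def certificateTwo (a : ℕ) : Bool :=
  let L₃ := if a = 6 then ofList line₃.1 line₃.2.1
    ((addMonomial line₃.1 line₃.2.1 5).map (-1 * ·)) else toVec line₃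
  certificate 3 (2 * a + 2)
    (label 0 ((List.range a).map (pencilD line₁ line₂ 3)) ++
      (label 1 ((List.range a).map pencilC) ++ label 2 [L₃, toVec line₄]))
    (label 0 ((List.range a).map pencilA) ++ (label 1 ((List.range a).map pencilB) ++
      label 2 [toVec line₁, toVec line₂]))
    (peelLines a [toVec line₁, toVec line₂, L₃, toVec line₄])

/-- Certificate for the class sizes `a, a, 1, 1`. -/
def certificateOneOne (a : ℕ) : Bool :=
  certificate 4 (2 * a + 2)
    (label 0 ((List.range a).map (pencilD line₁ line₂ 2)) ++
      (label 1 ((List.range a).map pencilC) ++ [(2, toVec line₃), (3, toVec line₄)]))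
    (label 0 ((List.range a).map pencilA) ++ (label 1 ((List.range a).map pencilB) ++
      [(2, toVec line₁), (3, toVec line₂)]))
    (peelLines a [toVec line₁, toVec line₂, toVec line₃, toVec line₄])

lemma certificateTwo_eq_true : ∀ a ∈ [2, 3, 4, 5, 6], certificateTwo a = true := by
  decide +kernel

lemma certificateOneOne_eq_true : ∀ a ∈ [1, 2, 3, 4], certificateOneOne a = true := by
  decide +kernel

/-- Certificate for the class sizes `2, 1, 1, 1, 1`. -/
def certificateOnes : Bool :=
  let L₂ := ofList line₂.1 line₂.2.1 []
  let L₃ := ofList [] line₃.2.1 line₃.2.2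
  certificate 5 6
    (label 0 ((List.range 2).map (pencilD line₁ line₂ 2)) ++
      [(1, pencilC 0), (4, pencilC 1), (2, L₃), (3, toVec line₄)])
    (label 0 ((List.range 2).map pencilA) ++
      [(1, pencilB 0), (4, pencilB 1), (2, toVec line₁), (3, L₂)])
    (peelLines 2 [toVec line₁, L₃, L₂, toVec line₄])

lemma certificateOnes_eq_true : certificateOnes = true := by
  decide +kernel

/-- An arrangement with class sizes `4, 3, 3`. -/
def arrangement₁ : List (ℕ × KVec) := [
  (0, ofList [1, -1, -1] [0, -1] [1, -1, -1]),
  (0, ofList [] [-1, 1, -1] [-1, 0, 1]),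
  (0, ofList [0, 1, 1] [1, 0, -1] [1, 1]),
  (0, ofList [1, -1] [0, -1, 1] [1, 0, -1]),
  (1, ofList [] [1] []),
  (1, ofList [0, 0, -2, 0, 2, 5, 3] [0, 0, -2, -2, -1, 1, 2, -2, -2] [0, 0, -2, -2, -1, 5, 10, 3,
     -1]),
  (1, ofList [0, 0, 0, 2, 10, 16, 6, -11, -24, -41, -68, -84, -44, 47, 111, 99, 49, 14, 2] [0, 0,
     0, -2, -12, -28, -24, 31, 100, 74, -53, -119, 1, 196, 230, 76, -75, -104, -57, -16, -2] [0,
     0, 0, -2, -12, -28, -28, 9, 62, 72, 21, -25, 29, 167, 220, 110, -29, -73, -45, -14, -2]),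
  (2, ofList [1] [] []),
  (2, ofList [0, 1, -2, -8, -11, -12, -7, -3, -4, -2] [0, 2, 8, 6, -3, -7, -3, 8, 10, 3] [0, 2, 8,
     14, 10, -9, -27, -29, -19, -4, 4, 2]),
  (2, ofList [0, 0, 0, 0, -2, -4, 7, 23, 32, 7, -173, -471, -589, -408, -144, -95, -281, -397,
     -290, -109, -4, 14, 4] [0, 0, 0, 0, 0, -6, -24, -19, 56, 180, 278, 308, 339, 407, 405, 306,
     211, 177, 161, 97, 18, -10, -4] [0, 0, 0, 0, 0, -6, -24, -17, 70, 221, 332, 270, 26, -198,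
     -142, 172, 328, 34, -454, -659, -448, -127, 20, 22, 4])]

/-- Another arrangement with class sizes `4, 3, 3`. -/
def arrangement₂ : List (ℕ × KVec) := [
  (0, ofList [-1] [1, 1, 1] [1, 1, 1]),
  (0, ofList [-1, 0, -1] [0, 1, 1] [0, 1, 1, 1, 1]),
  (0, ofList [1, 1] [0, 0, -1] [0, 0, 1, 1]),
  (0, ofList [-1, 1, 1] [-1, 0, 1] [-1, 1, 2, -1, -1]),
  (1, ofList [-1, 0, -1] [1, 1, 1] [1, 1, 2, 1, 1]),
  (1, ofList [-1] [-1, 0, 1] [-1, 0, 1]),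
  (1, ofList [0, 0, 0, -2, -6, 1, 19, 20, -1, -22, -25, -12, -2] [0, 0, 0, -2, -7, -4, 11, 21, 14,
     -8, -19, -7, 5, 6, 2] [0, 0, 0, 0, 1, 2, -1, -1, 6, 1, -14, -14, -4]),
  (2, ofList [-1, 1, 1] [0, 0, -1] [0, 0, -1, 1, 1]),
  (2, ofList [1, 1] [0, 1, 1] [0, -1, -2, -1]),
  (2, ofList [0, 3, 4, -10, -29, -19, 20, 41, 23, -10, -22, -7, 4, 2] [0, 0, -3, -10, 4, 40, 60,
     39, -3, -9, 27, 53, 39, 9, -4, -2] [0, 0, -3, -2, 9, 17, 17, 15, 31, 74, 104, 87, 40, 3,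
     -6, -2])]

/-- Lines covering the points of intersection of the two arrangements. -/
def coveringLines : List KVec :=
  ((arrangement₁.drop 4) ++ [6, 9, 4, 5, 8].filterMap (arrangement₂[·]?)).map Prod.snd

lemma certificate_arrangements :
    certificate 3 10 arrangement₁ arrangement₂ coveringLines = true := by
  decide +kernel

variable {k : Type*} [Field k] [Infinite k]

lemma HasConfig.of_certificate_of_eq {r e : ℕ} [NeZero r] {F G : List (ℕ × KVec)} {ls : List KVec}
    {c : Fin r → ℕ} (h : certificate r e F G ls = true) (hc : ∀ i : Fin r, countClass F i = c i) :
    HasConfig k r e c :=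
  funext hc ▸ HasConfig.of_certificate h

lemma hasConfig_two {a : ℕ} (h2 : 2 ≤ a) (h6 : a ≤ 6) : HasConfig k 3 (2 * a + 2) ![a, a, 2] := by
  have h := certificateTwo_eq_true a (by simp; omega)
  rw [certificateTwo] at h
  refine .of_certificate_of_eq h ?_
  interval_cases a <;> decide +kernel

lemma hasConfig_oneOne {a : ℕ} (h1 : 1 ≤ a) (h4 : a ≤ 4) :
    HasConfig k 4 (2 * a + 2) ![a, a, 1, 1] := by
  have h := certificateOneOne_eq_true a (by simp; omega)
  rw [certificateOneOne] at h
  refine .of_certificate_of_eq h ?_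
  interval_cases a <;> decide +kernel

lemma hasConfig_ones : HasConfig k 5 6 ![2, 1, 1, 1, 1] :=
  .of_certificate_of_eq certificateOnes_eq_true (by decide +kernel)

lemma hasConfig_threeThree : HasConfig k 3 10 ![4, 3, 3] :=
  .of_certificate_of_eq certificate_arrangements (by decide +kernel)

end Certificates

section Pencils

open Matrix Filter

variable {k : Type*} [Field k]

lemma Indep.peel_range {e : ℕ} {Z : List (Fin 3 → k)} (hZ : Indep e Z) {L : ℕ → Fin 3 → k}
    {S : ℕ → List (Fin 3 → k)} (m : ℕ) (hZL : ∀ q < m, ∀ P ∈ Z, L q ⬝ᵥ P ≠ 0)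
    (hSL : ∀ q < m, ∀ u < m, ∀ P ∈ S u, L q ⬝ᵥ P = 0 ↔ q = u)
    (hS0 : ∀ q < m, ∀ P ∈ S q, P ≠ 0) (hSp : ∀ q < m, (S q).Pairwise NonProp)
    (hS : ∀ q < m, (S q).length ≤ e + q + 2) :
    Indep (e + m) (Z ++ (List.range m).flatMap S) := by
  induction m with
  | zero => simpa using hZ
  | succ m ih =>
    have ih := ih (fun q hq => hZL q (by omega)) (fun q hq u hu => hSL q (by omega) u (by omega))
      (fun q hq => hS0 q (by omega)) (fun q hq => hSp q (by omega)) (fun q hq => hS q (by omega))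
    rw [List.range_succ, List.flatMap_append, ← List.append_assoc, ← add_assoc]
    simp only [List.flatMap_cons, List.flatMap_nil, List.append_nil]
    refine ih.peel (L m) (fun P hP => ?_) (fun P hP => ?_)
      (Indep.of_length_le (hS0 m (by omega)) (hSp m (by omega)) (hS m (by omega)))
    · rcases List.mem_append.1 hP with hP | hP
      · exact hZL m (by omega) P hP
      · obtain ⟨u, hu, hP⟩ := List.mem_flatMap.1 hP
        rw [List.mem_range] at hu
        rw [Ne, hSL m (by omega) u (by omega) P hP]
        omega
    · exact (hSL m (by omega) m (by omega) P hP).2 rfl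

lemma pts_map_append_map {ι : Type*} [DecidableEq ι] {i j : ι} (hij : i ≠ j)
    (l₁ l₂ : List (Fin 3 → k)) :
    pts (l₁.map (Prod.mk i) ++ l₂.map (Prod.mk j)) = l₁.flatMap fun L => l₂.map (L ⨯₃ ·) := by
  have h (j : ι) (l : List (Fin 3 → k)) : pts (l.map (Prod.mk j)) = [] := by
    induction l with
    | nil => rfl
    | cons L l ih => simp [pts, ih]
  induction l₁ with
  | nil => simpa using h j l₂
  | cons L l₁ ih =>
    simp [pts, ih, List.filter_map, Function.comp_def, hij.symm]

lemma exists_pow_injOn [Infinite k] (n : ℕ) :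
    ∃ t : k, ∀ u < n, ∀ v < n, t ^ u = t ^ v ↔ u = v := by
  have h : ∀ u ∈ List.range n, ∀ᶠ t : k in cofinite, ∀ v ∈ List.range n, u ≠ v → t ^ u ≠ t ^ v := by
    refine fun u _ => eventually_forall_mem_list _ fun v _ => ?_
    by_cases huv : u = v
    · simp [huv]
    have h0 : (Polynomial.X ^ u - Polynomial.X ^ v : Polynomial k) ≠ 0 := by
      rw [sub_ne_zero]
      exact fun h => huv (by simpa using congrArg Polynomial.natDegree h)
    filter_upwards [eventually_eval_ne_zero h0] with t ht _
    simpa [sub_eq_zero] using ht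
  obtain ⟨t, ht⟩ := (eventually_forall_mem_list _ h).exists
  refine ⟨t, fun u hu v hv => ⟨fun h => ?_, fun h => h ▸ rfl⟩⟩
  by_contra huv
  exact ht u (by simpa) v (by simpa) huv h

/-- The grid is the union of its antidiagonals and of a triangle. -/
lemma triangle_append_antidiagonal_perm (b : ℕ) :
    (((List.range b).flatMap fun i => (List.range (i + 1)).map fun u => (i, b - i + u)) ++
      (List.range b).flatMap List.Nat.antidiagonal).Perm
    ((List.range b).flatMap fun i => (List.range (b + 1)).map (Prod.mk i)) := by
  refine (List.perm_ext_iff_of_nodup ?_ ?_).2 ?_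
  · refine List.nodup_append'.2 ⟨?_, ?_, ?_⟩
    · refine List.nodup_flatMap.2 ⟨fun i _ => List.nodup_range.map fun u v h => ?_,
        List.nodup_range.pairwise_of_forall_ne fun i _ j _ hij => ?_⟩
      · simpa using h
      · rintro ⟨x, y⟩ h₁ h₂
        simp only [List.mem_map, Prod.mk.injEq] at h₁ h₂
        omega
    · refine List.nodup_flatMap.2 ⟨fun i _ => List.Nat.nodup_antidiagonal i,
        List.nodup_range.pairwise_of_forall_ne fun i _ j _ hij => ?_⟩
      rintro ⟨x, y⟩ h₁ h₂
      simp only [List.Nat.mem_antidiagonal] at h₁ h₂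
      omega
    · rintro ⟨x, y⟩ h₁ h₂
      simp only [List.mem_flatMap, List.mem_map, List.mem_range, Prod.mk.injEq,
        List.Nat.mem_antidiagonal] at h₁ h₂
      omega
  · refine List.nodup_flatMap.2 ⟨fun i _ => List.nodup_range.map fun u v h => ?_,
      List.nodup_range.pairwise_of_forall_ne fun i _ j _ hij => ?_⟩
    · simpa using h
    · rintro ⟨x, y⟩ h₁ h₂
      simp only [List.mem_map, Prod.mk.injEq] at h₁ h₂
      omega
  · rintro ⟨x, y⟩
    simp only [List.mem_append, List.mem_flatMap, List.mem_map, List.mem_range, Prod.mk.injEq,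
      List.Nat.mem_antidiagonal]
    constructor
    · rintro (⟨i, hi, u, hu, rfl, rfl⟩ | ⟨i, hi, h⟩)
      · exact ⟨i, hi, b - i + u, by omega, rfl, rfl⟩
      · exact ⟨x, by omega, y, by omega, rfl, rfl⟩
    · rintro ⟨i, hi, j, hj, rfl, rfl⟩
      by_cases h : i + j < b
      · exact .inr ⟨i + j, h, rfl⟩
      · exact .inl ⟨i, hi, j - (b - i), by omega, rfl, by omega⟩

end Pencils

section Base

open Matrix Filter

variable {k : Type*} [Field k]

/-- The lines of three pencils. -/
def lineA (t : k) (n : ℕ) : Fin 3 → k := ![1, 0, -t ^ n]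

/-- The lines of a second pencil. -/
def lineB (t : k) (n : ℕ) : Fin 3 → k := ![1, -t ^ n, 0]

/-- The lines of a third pencil. -/
def lineC (t : k) (n : ℕ) : Fin 3 → k := ![0, t ^ n, -1]

lemma lineB_cross_lineA (t : k) (m n : ℕ) :
    lineB t m ⨯₃ lineA t n = ![t ^ m * t ^ n, t ^ n, t ^ m] := by
  simp [lineA, lineB, cross_apply]

lemma lineA_cross_lineC (t : k) (m n : ℕ) :
    lineA t m ⨯₃ lineC t n = ![t ^ (m + n), 1, t ^ n] := by
  simp [lineA, lineC, cross_apply, pow_add]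

lemma nonProp_iff {P Q : Fin 3 → k} : NonProp P Q ↔ ¬(P 1 * Q 2 = P 2 * Q 1 ∧
    P 2 * Q 0 = P 0 * Q 2 ∧ P 0 * Q 1 = P 1 * Q 0) := by
  simp [NonProp, cross_apply, sub_eq_zero]

lemma pairwise_nonProp_map {α : Type*} {l : List α} {f : α → Fin 3 → k} (hl : l.Nodup)
    (h : ∀ x ∈ l, ∀ y ∈ l, x ≠ y → NonProp (f x) (f y)) : (l.map f).Pairwise NonProp := by
  rw [List.pairwise_map]
  exact hl.pairwise_of_forall_ne h

/-- The points of two grids of lines impose independent conditions. -/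
lemma indep_grids {b : ℕ} {t : k} (ht : ∀ u < 4 * b + 4, ∀ v < 4 * b + 4, t ^ u = t ^ v ↔ u = v) :
    Indep (2 * b)
      (((List.range b).flatMap fun q => (List.range (b + 1)).map fun i =>
          lineB t q ⨯₃ lineA t (b + 1 + i)) ++
        (List.range b).flatMap fun i => (List.range (b + 1)).map fun j =>
          lineA t i ⨯₃ lineC t j) := by
  have t0 : t ≠ 0 := by
    rintro rfl
    simpa using ht 1 (by omega) 2 (by omega)
  simp only [lineB_cross_lineA, lineA_cross_lineC]
  have h₁ := Indep.peel_range (e := 0) (Z := []) trivial (L := lineA t)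
    (S := fun i => (List.range (i + 1)).map fun u => ![t ^ (i + (b - i + u)), 1, t ^ (b - i + u)])
    b (by simp) (by
      intro q hq i hi P hP
      obtain ⟨u, hu, rfl⟩ := List.mem_map.1 hP
      rw [List.mem_range] at hu
      simp [lineA, ← sub_eq_add_neg, sub_eq_zero, ← pow_add]
      rw [ht _ (by omega) _ (by omega)]
      omega) (by
      intro q hq P hP h
      obtain ⟨u, hu, rfl⟩ := List.mem_map.1 hP
      simpa using congrFun h 1) (by
      refine fun q hq => pairwise_nonProp_map List.nodup_range fun u hu v hv huv => ?_
      rw [List.mem_range] at hu hv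
      rw [nonProp_iff]
      rintro ⟨h, -, -⟩
      simp only [Matrix.cons_val, one_mul, mul_one] at h
      rw [ht _ (by omega) _ (by omega)] at h
      omega) (by simp)
  have h₂ := h₁.peel_range (L := lineB t) (S := fun q =>
      ((List.range (b + 1)).map fun i =>
        ![t ^ q * t ^ (b + 1 + i), t ^ (b + 1 + i), t ^ q]) ++
      (List.Nat.antidiagonal q).map fun x => ![t ^ (x.1 + x.2), 1, t ^ x.2]) b (by
      intro q hq P hP
      simp only [List.nil_append, List.mem_flatMap, List.mem_map, List.mem_range] at hP
      obtain ⟨i, hi, u, hu, rfl⟩ := hP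
      simp [lineB, ← sub_eq_add_neg, sub_eq_zero]
      rw [ht _ (by omega) _ (by omega)]
      omega) (by
      intro q hq u hu P hP
      simp only [List.mem_append, List.mem_map, List.mem_range, List.Nat.mem_antidiagonal] at hP
      rcases hP with ⟨i, hi, rfl⟩ | ⟨⟨i, j⟩, rfl, rfl⟩
      · simp [lineB, ← sub_eq_add_neg, sub_eq_zero, t0]
        rw [ht _ (by omega) _ (by omega), eq_comm]
      · simp [lineB, ← sub_eq_add_neg, sub_eq_zero]
        rw [ht _ (by omega) _ (by omega), eq_comm]) (by
      intro q hq P hP h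
      simp only [List.mem_append, List.mem_map] at hP
      rcases hP with ⟨i, hi, rfl⟩ | ⟨⟨i, j⟩, -, rfl⟩
      · simpa [t0] using congrFun h 1
      · simpa using congrFun h 1) (by
      intro q hq
      refine List.pairwise_append.2 ⟨?_, ?_, ?_⟩
      · refine pairwise_nonProp_map List.nodup_range fun u hu v hv huv => ?_
        rw [List.mem_range] at hu hv
        rw [nonProp_iff]
        rintro ⟨h, -, -⟩
        simp only [Matrix.cons_val, mul_comm, mul_right_inj' (pow_ne_zero q t0)] at h
        rw [ht _ (by omega) _ (by omega)] at h
        omega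
      · refine pairwise_nonProp_map (List.Nat.nodup_antidiagonal q) ?_
        rintro ⟨i, j⟩ h₁ ⟨i', j'⟩ h₂ h
        rw [List.Nat.mem_antidiagonal] at h₁ h₂
        rw [nonProp_iff]
        rintro ⟨h', -, -⟩
        simp only [Matrix.cons_val, one_mul, mul_one] at h'
        rw [ht _ (by omega) _ (by omega)] at h'
        simp only [Ne, Prod.mk.injEq] at h
        omega
      · intro P hP Q hQ
        simp only [List.mem_map, List.mem_range, List.Nat.mem_antidiagonal] at hP hQ
        obtain ⟨i, hi, rfl⟩ := hP
        obtain ⟨⟨x, y⟩, h, rfl⟩ := hQ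
        rw [nonProp_iff]
        rintro ⟨h', -, -⟩
        simp only [Matrix.cons_val, mul_one, ← pow_add] at h'
        rw [ht _ (by omega) _ (by omega)] at h'
        omega) (by
      intro q hq
      simp
      omega)
  rw [zero_add, ← two_mul] at h₂
  refine h₂.perm ?_
  have h₃ := (triangle_append_antidiagonal_perm b).map fun x : ℕ × ℕ =>
    (![t ^ (x.1 + x.2), 1, t ^ x.2] : Fin 3 → k)
  simp only [List.map_append, List.map_flatMap, List.map_map, Function.comp_def] at h₃
  refine ((List.flatMap_append_perm _ _ _).symm.append_left _).trans ?_
  refine .trans ?_ (h₃.append_left _)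
  rw [List.nil_append, ← Multiset.coe_eq_coe]
  simp only [← Multiset.coe_add]
  abel

end Base

section BaseConfig

open Matrix Filter

variable {k : Type*} [Field k]

lemma pts_cons_of_forall_ne {ι : Type*} [DecidableEq ι] {i : ι} {L : Fin 3 → k}
    {F : List (ι × (Fin 3 → k))} (hF : ∀ x ∈ F, x.1 ≠ i) :
    pts ((i, L) :: F) = (F.map Prod.snd).map (L ⨯₃ ·) ++ pts F := by
  rw [pts, List.filter_eq_self.2 (by simpa using hF), List.map_map]
  rfl

lemma hasConfig_one [Infinite k] (b : ℕ) : HasConfig k 3 (2 * b + 2) ![b, b + 1, 1] := by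
  obtain ⟨t, ht⟩ := exists_pow_injOn (k := k) (4 * b + 4)
  have t0 : t ≠ 0 := by
    rintro rfl
    simpa using ht 1 (by omega) 2 (by omega)
  have hA0 (n : ℕ) : lineA t n ≠ 0 := fun h => by simpa [lineA] using congrFun h 0
  have hB0 (n : ℕ) : lineB t n ≠ 0 := fun h => by simpa [lineB] using congrFun h 0
  have hC0 (n : ℕ) : lineC t n ≠ 0 := fun h => by simpa [lineC] using congrFun h 2
  have hAA {u v : ℕ} (hu : u < 4 * b + 4) (hv : v < 4 * b + 4) (huv : u ≠ v) :
      NonProp (lineA t u) (lineA t v) := by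
    simpa [nonProp_iff, lineA, ht u hu v hv, ht v hv u hu, eq_comm] using huv
  have hBB {u v : ℕ} (hu : u < 4 * b + 4) (hv : v < 4 * b + 4) (huv : u ≠ v) :
      NonProp (lineB t u) (lineB t v) := by
    simpa [nonProp_iff, lineB, ht u hu v hv, ht v hv u hu, eq_comm] using huv
  have hCC {u v : ℕ} (hu : u < 4 * b + 4) (hv : v < 4 * b + 4) (huv : u ≠ v) :
      NonProp (lineC t u) (lineC t v) := by
    simpa [nonProp_iff, lineC, ht u hu v hv, ht v hv u hu, eq_comm] using huv
  have hBA (u v : ℕ) : NonProp (lineB t u) (lineA t v) := by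
    simp [nonProp_iff, lineA, lineB, t0]
  have hAC (u v : ℕ) : NonProp (lineA t u) (lineC t v) := by
    simp [nonProp_iff, lineA, lineC, t0]
  let F₀ := (List.range b).map (lineB t)
  let F₁ := (List.range (b + 1)).map fun i => lineA t (b + 1 + i)
  let G₀ := (List.range b).map (lineA t)
  let G₁ := (List.range (b + 1)).map (lineC t)
  have hF₁p : F₁.Pairwise NonProp := pairwise_nonProp_map List.nodup_range fun u hu v hv huv => by
    rw [List.mem_range] at hu hv
    exact hAA (by omega) (by omega) (by omega)
  have hG₁p : G₁.Pairwise NonProp := pairwise_nonProp_map List.nodup_range fun u hu v hv huv => by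
    rw [List.mem_range] at hu hv
    exact hCC (by omega) (by omega) (by omega)
  have hFp : (F₀ ++ F₁).Pairwise NonProp := by
    refine List.pairwise_append.2 ⟨pairwise_nonProp_map List.nodup_range fun u hu v hv huv => ?_,
      hF₁p, List.forall_mem_map.2 fun u _ => List.forall_mem_map.2 fun v _ => hBA _ _⟩
    rw [List.mem_range] at hu hv
    exact hBB (by omega) (by omega) (by omega)
  have hGp : (G₀ ++ G₁).Pairwise NonProp := by
    refine List.pairwise_append.2 ⟨pairwise_nonProp_map List.nodup_range fun u hu v hv huv => ?_,
      hG₁p, List.forall_mem_map.2 fun u _ => List.forall_mem_map.2 fun v _ => hAC _ _⟩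
    rw [List.mem_range] at hu hv
    exact hAA (by omega) (by omega) (by omega)
  have hFG : (F₁ ++ G₁).Pairwise NonProp := List.pairwise_append.2 ⟨hF₁p, hG₁p,
    List.forall_mem_map.2 fun u _ => List.forall_mem_map.2 fun v _ => hAC _ _⟩
  have hF0 : ∀ L ∈ F₀ ++ F₁, L ≠ 0 := List.forall_mem_append.2
    ⟨List.forall_mem_map.2 fun u _ => hB0 u, List.forall_mem_map.2 fun u _ => hA0 _⟩
  have hG0 : ∀ L ∈ G₀ ++ G₁, L ≠ 0 := List.forall_mem_append.2
    ⟨List.forall_mem_map.2 fun u _ => hA0 u, List.forall_mem_map.2 fun u _ => hC0 u⟩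
  have hFG0 : ∀ L ∈ F₁ ++ G₁, L ≠ 0 := List.forall_mem_append.2
    ⟨List.forall_mem_map.2 fun u _ => hA0 _, List.forall_mem_map.2 fun u _ => hC0 u⟩
  let F := F₀.map (Prod.mk (0 : Fin 3)) ++ F₁.map (Prod.mk (1 : Fin 3))
  let G := G₀.map (Prod.mk (0 : Fin 3)) ++ G₁.map (Prod.mk (1 : Fin 3))
  have hFpts : pts F = F₀.flatMap fun L => F₁.map (L ⨯₃ ·) := pts_map_append_map (by simp) _ _
  have hGpts : pts G = G₀.flatMap fun L => G₁.map (L ⨯₃ ·) := pts_map_append_map (by simp) _ _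
  have hI : Indep (2 * b) (pts F ++ pts G) := by
    rw [hFpts, hGpts]
    simpa [F₀, F₁, G₀, G₁, List.flatMap_map, Function.comp_def] using indep_grids ht
  have hI0 : ∀ P ∈ pts F ++ pts G, P ≠ 0 := by
    rcases eq_or_ne b 0 with rfl | hb
    · simp [hFpts, hGpts, F₀, G₀]
    · exact hI.ne_zero (by omega)
  obtain ⟨x, hx, hxFG⟩ := ((hI.eventually_append hI0 hF0 hFp (by simp [F₀, F₁]; omega)).and
    (eventually_forall_mem_list _ fun L hL => eventually_conicLine_nonProp (hFG0 L hL))).exists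
  have hx0 : conicLine x ≠ 0 := fun h => by simpa [conicLine] using congrFun h 0
  obtain ⟨y, hy, hyFG, hxy⟩ := ((hx.eventually_append (hx.ne_zero (by omega)) hG0 hGp
    (by simp [G₀, G₁]; omega)).and ((eventually_forall_mem_list _ fun L hL =>
      eventually_conicLine_nonProp (hFG0 L hL)).and (eventually_conicLine_nonProp hx0))).exists
  have hy0 : conicLine y ≠ 0 := fun h => by simpa [conicLine] using congrFun h 0
  have hoF : otherLines ((2, conicLine x) :: F) = conicLine x :: F₁ := by
    simp [otherLines, F, List.filter_map, Function.comp_def]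
  have hoG : otherLines ((2, conicLine y) :: G) = conicLine y :: G₁ := by
    simp [otherLines, G, List.filter_map, Function.comp_def]
  have hF2 : ∀ z ∈ F, z.1 ≠ 2 := by
    intro z hz
    simp only [F, List.mem_append, List.mem_map] at hz
    rcases hz with ⟨L, -, rfl⟩ | ⟨L, -, rfl⟩ <;> simp
  have hG2 : ∀ z ∈ G, z.1 ≠ 2 := by
    intro z hz
    simp only [G, List.mem_append, List.mem_map] at hz
    rcases hz with ⟨L, -, rfl⟩ | ⟨L, -, rfl⟩ <;> simp
  refine ⟨(2, conicLine x) :: F, (2, conicLine y) :: G, ?_, ?_, ?_, ?_, ?_⟩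
  · intro i
    fin_cases i <;> simp [classLines, F, F₀, F₁, List.filter_map, Function.comp_def]
  · intro i
    fin_cases i <;> simp [classLines, G, G₀, G₁, List.filter_map, Function.comp_def]
  · intro L hL
    rw [hoF, hoG, List.perm_middle.mem_iff, List.cons_append, List.mem_cons, List.mem_cons] at hL
    rcases hL with rfl | rfl | hL
    exacts [hy0, hx0, hFG0 L hL]
  · rw [hoF, hoG, List.perm_middle.pairwise_iff NonProp.symm, List.cons_append]
    exact .cons (List.forall_mem_cons.2 ⟨hxy, hyFG⟩) (.cons hxFG hFG)
  · rw [pts_cons_of_forall_ne hF2, pts_cons_of_forall_ne hG2]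
    have h1 : F.map Prod.snd = F₀ ++ F₁ := by simp [F, Function.comp_def]
    have h2 : G.map Prod.snd = G₀ ++ G₁ := by simp [G, Function.comp_def]
    rw [h1, h2]
    refine hy.perm ?_
    rw [← Multiset.coe_eq_coe]
    simp only [← Multiset.coe_add]
    abel

end BaseConfig

section Numerics

variable {r : ℕ} [NeZero r]

lemma filter_val_ne_zero : univ.filter (fun i : Fin r => i.val ≠ 0) = univ.erase 0 := by
  ext i
  rw [mem_filter, mem_erase, Fin.val_ne_zero_iff, and_comm]

lemma sum_eq_add_sval (d : Fin r → ℕ) : ∑ i, d i = d 0 + sval d := by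
  rw [sval, filter_val_ne_zero, Finset.add_sum_erase _ _ (mem_univ 0)]

lemma sval_update (d : Fin r → ℕ) (n : ℕ) : sval (Function.update d 0 n) = sval d := by
  rw [sval, sval, filter_val_ne_zero]
  exact Finset.sum_congr rfl fun i hi => Function.update_of_ne (Finset.ne_of_mem_erase hi) _ _

lemma Dval_eq (d : Fin r → ℕ) : Dval d = d 0 * sval d + pval d := by
  rw [Dval, ← Finset.sum_filter_not_add_sum_filter _ fun q : Fin r × Fin r => q.1.val ≠ 0,
    Finset.filter_filter, Finset.filter_filter, pval, add_left_inj, sval, Finset.mul_sum]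
  refine Finset.sum_bij' (fun q _ => q.2) (fun j _ => (0, j)) ?_ ?_ ?_ ?_ ?_
  · rintro ⟨i, j⟩ h
    rw [mem_filter, Fin.lt_def] at h
    exact mem_filter.2 ⟨mem_univ _, by simp only at h ⊢; omega⟩
  · intro j h
    rw [mem_filter] at h
    refine mem_filter.2 ⟨mem_univ _, ?_⟩
    simp only [Fin.lt_def, Fin.val_zero]
    omega
  · rintro ⟨i, j⟩ h
    have hi : i = 0 := by simpa using (mem_filter.1 h).2.2
    rw [hi]
  · exact fun _ _ => rfl
  · rintro ⟨i, j⟩ h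
    have hi : i = 0 := by simpa using (mem_filter.1 h).2.2
    rw [hi]

lemma two_mul_pval_add (d : Fin r → ℕ) :
    2 * pval d + ∑ i ∈ univ.erase 0, d i ^ 2 = sval d ^ 2 := by
  have h1 := two_mul_Dval_add d
  have h2 := Finset.add_sum_erase univ (fun i => d i ^ 2) (mem_univ 0)
  rw [Dval_eq, sum_eq_add_sval d, ← h2] at h1
  linarith

lemma le_five_of_two_mul_pval_le {d : Fin r → ℕ} (hpos : ∀ i, 1 ≤ d i)
    (hps : 2 * pval d ≤ 3 * sval d) : r ≤ 5 := by
  by_contra! h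
  have h1 := two_mul_pval_add d
  have h2 : ∀ i ∈ univ.erase 0, d i ^ 2 + 4 * d i ≤ d i * sval d := by
    intro i hi
    have h3 := Finset.add_sum_erase _ d hi
    have h4 : ((univ.erase 0).erase i).card • 1 ≤ ∑ j ∈ (univ.erase 0).erase i, d j :=
      Finset.card_nsmul_le_sum _ _ _ fun j _ => hpos j
    rw [Finset.card_erase_of_mem hi, Finset.card_erase_of_mem (mem_univ _), card_univ,
      Fintype.card_fin, smul_eq_mul] at h4
    have h5 : d i + 4 ≤ sval d := by
      rw [sval, filter_val_ne_zero]
      omega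
    nlinarith
  have h3 := Finset.sum_le_sum h2
  rw [Finset.sum_add_distrib, ← Finset.mul_sum, ← Finset.sum_mul] at h3
  have h4 : ∑ i ∈ univ.erase 0, d i = sval d := by rw [sval, filter_val_ne_zero]
  have h5 : 0 < sval d := by
    rw [← h4]
    refine Finset.sum_pos (fun i _ => hpos i) ⟨⟨1, by omega⟩, ?_⟩
    rw [← filter_val_ne_zero]
    simp
  rw [h4] at h3
  nlinarith

lemma two_mul_choose_two (n : ℕ) : 2 * (n.choose 2 : ℤ) = n * (n - 1) := by
  cases n with
  | zero => simp
  | succ n =>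
    have h := Nat.div_mul_cancel (Nat.even_mul_pred_self (n + 1)).two_dvd
    rw [← Nat.choose_two_right] at h
    have h' := congrArg (Nat.cast (R := ℤ)) h
    push_cast at h' ⊢
    linarith

lemma expected_dimension_eq {d : Fin r → ℕ} (hds : sval d ≤ d 0 + 1) :
    ((((∑ i, d i) + 2).choose 2 : ℕ) : ℤ) - 2 * (Dval d : ℤ) =
      (((d 0 + 2 - sval d).choose 2 : ℕ) : ℤ) + 3 * (sval d : ℤ) - 2 * (pval d : ℤ) := by
  have h1 := two_mul_choose_two ((∑ i, d i) + 2)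
  have h2 := two_mul_choose_two (d 0 + 2 - sval d)
  rw [Nat.cast_sub (by omega)] at h2
  rw [Dval_eq]
  rw [sum_eq_add_sval] at h1 ⊢
  push_cast at h1 h2 ⊢
  linarith

end Numerics

section Main

variable {k : Type*} [Field k] [Infinite k]

lemma hasConfig_of_two_mul_pval_le {r : ℕ} [NeZero r] {d : Fin r → ℕ} (hr : 2 < r)
    (hanti : ∀ i j, i ≤ j → d j ≤ d i) (hpos : ∀ i, 1 ≤ d i) (hps : 2 * pval d ≤ 3 * sval d) :
    HasConfig k r (2 * sval d - 2) (Function.update d 0 (sval d - 2)) := by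
  have h5 := le_five_of_two_mul_pval_le hpos hps
  have hp := two_mul_pval_add d
  have hs : sval d = ∑ i ∈ univ.erase 0, d i := by rw [sval, filter_val_ne_zero]
  rw [← filter_val_ne_zero] at hp hs
  obtain rfl | rfl | rfl : r = 3 ∨ r = 4 ∨ r = 5 := by omega
  · have h21 : d 2 ≤ d 1 := hanti 1 2 (Fin.le_def.2 (by simp))
    have h2 := hpos 2
    have hu : d = ![d 0, d 1, d 2] := by
      funext i
      fin_cases i <;> rfl
    generalize d 0 = x, d 1 = a, d 2 = b at *
    subst hu
    simp [Finset.sum_filter, Fin.sum_univ_succ] at hs hp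
    rw [hs] at hps hp ⊢
    have hb : b < 4 := by
      by_contra! hb
      nlinarith
    have hu : Function.update ![x, a, b] 0 (a + b - 2) = ![a + b - 2, a, b] := by
      funext i
      fin_cases i <;> rfl
    rw [hu]
    interval_cases b
    · obtain ⟨a, rfl⟩ := Nat.exists_eq_add_of_le' h21
      exact hasConfig_one a
    · exact hasConfig_two h21 (by nlinarith)
    · obtain rfl : a = 3 := by nlinarith
      exact hasConfig_threeThree
  · have h21 : d 2 ≤ d 1 := hanti 1 2 (Fin.le_def.2 (by simp))
    have h32 : d 3 ≤ d 2 := hanti 2 3 (Fin.le_def.2 (by simp))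
    have h3 := hpos 3
    have hu : d = ![d 0, d 1, d 2, d 3] := by
      funext i
      fin_cases i <;> rfl
    generalize d 0 = x, d 1 = a, d 2 = b, d 3 = c at *
    subst hu
    simp [Finset.sum_filter, Fin.sum_univ_succ] at hs hp
    rw [hs] at hps hp ⊢
    obtain rfl : b = 1 := by
      by_contra hb
      have hb : 2 ≤ b := by omega
      nlinarith [Nat.mul_le_mul_left a hb, Nat.mul_le_mul_left a h3, Nat.mul_le_mul_left b h3,
        Nat.mul_le_mul_right c hb, Nat.mul_le_mul_right c (hb.trans h21),
        Nat.mul_le_mul_right b (hb.trans h21)]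
    obtain rfl : c = 1 := by omega
    have hu : Function.update ![x, a, 1, 1] 0 (a + (1 + 1) - 2) = ![a, a, 1, 1] := by
      funext i
      fin_cases i <;> rfl
    rw [hu]
    exact hasConfig_oneOne h21 (by nlinarith)
  · have h1 := hpos 1
    have h2 := hpos 2
    have h3 := hpos 3
    have h4 := hpos 4
    have hu : d = ![d 0, d 1, d 2, d 3, d 4] := by
      funext i
      fin_cases i <;> rfl
    generalize d 0 = x, d 1 = a, d 2 = b, d 3 = c, d 4 = e at *
    subst hu
    simp [Finset.sum_filter, Fin.sum_univ_succ] at hs hp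
    rw [hs] at hps hp ⊢
    have ht : a + b + c + e ≤ 4 := by
      obtain ⟨a, rfl⟩ := Nat.exists_eq_add_of_le' h1
      obtain ⟨b, rfl⟩ := Nat.exists_eq_add_of_le' h2
      obtain ⟨c, rfl⟩ := Nat.exists_eq_add_of_le' h3
      obtain ⟨e, rfl⟩ := Nat.exists_eq_add_of_le' h4
      nlinarith [mul_nonneg a.zero_le b.zero_le, mul_nonneg a.zero_le c.zero_le,
        mul_nonneg a.zero_le e.zero_le, mul_nonneg b.zero_le c.zero_le,
        mul_nonneg b.zero_le e.zero_le, mul_nonneg c.zero_le e.zero_le]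
    obtain ⟨rfl, rfl, rfl, rfl⟩ : a = 1 ∧ b = 1 ∧ c = 1 ∧ e = 1 := by omega
    have hu : Function.update ![x, 1, 1, 1, 1] 0 (1 + (1 + (1 + 1)) - 2) = ![2, 1, 1, 1, 1] := by
      funext i
      fin_cases i <;> rfl
    rw [hu]
    exact hasConfig_ones

lemma exists_forms_of_two_mul_pval_le {r : ℕ} [NeZero r] {d : Fin r → ℕ} (hr : 2 < r)
    (hanti : ∀ i j, i ≤ j → d j ≤ d i) (hpos : ∀ i, 1 ≤ d i) (hds : sval d ≤ d 0 + 1)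
    (hps : 2 * pval d ≤ 3 * sval d) :
    ∃ F G : Fin r → MvPolynomial (Fin 3) k,
      (∀ i, F i ≠ 0 ∧ (F i).IsHomogeneous (d i)) ∧
      (∀ i, G i ≠ 0 ∧ (G i).IsHomogeneous (d i)) ∧
      gradedDim (idealOfForms F ⊓ idealOfForms G) (∑ i, d i) + 2 * Dval d =
        ((∑ i, d i) + 2).choose 2 := by
  have hs : 2 ≤ sval d := by
    rw [sval, filter_val_ne_zero]
    have h : (univ.erase (0 : Fin r)).card • 1 ≤ ∑ i ∈ univ.erase 0, d i :=
      Finset.card_nsmul_le_sum _ _ _ fun i _ => hpos i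
    rw [Finset.card_erase_of_mem (mem_univ _), card_univ, Fintype.card_fin, smul_eq_mul] at h
    omega
  have h := (hasConfig_of_two_mul_pval_le (k := k) hr hanti hpos hps).steps (by omega)
    (by rw [sum_eq_add_sval, sval_update, Function.update_self]; omega) (d 0 + 2 - sval d)
  rw [Function.update_idem, Function.update_self,
    show sval d - 2 + (d 0 + 2 - sval d) = d 0 by omega, Function.update_eq_self,
    show 2 * sval d - 2 + (d 0 + 2 - sval d) = ∑ i, d i by rw [sum_eq_add_sval]; omega] at h
  exact h.exists_forms (by omega) (by rw [sum_eq_add_sval]; omega) hpos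

end Main

/-- Lemma 4.9: if `r > 2`, `d₁ ≥ s - 1` and `2p - 3s ≤ 0`, then
`C(d+2,2) - 2D = C(d₁-s+2,2) + 3s - 2p ≥ 0` and for general `[F], [G] ∈ X_{2,λ}`
one has `dim (I_F ∩ I_G)_d = C(d+2,2) - 2D`. -/
theorem expected_dimension_balanced_above
    {k : Type*} [Field k] [IsAlgClosed k]
    (r : ℕ) [NeZero r] (hr : 2 < r)
    (d : Fin r → ℕ)
    (hanti : ∀ i j : Fin r, i ≤ j → d j ≤ d i)
    (hpos : ∀ i, 1 ≤ d i)
    (hds : sval d ≤ d 0 + 1)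
    (hps : 2 * pval d ≤ 3 * sval d) :
    ((((∑ i, d i) + 2).choose 2 : ℤ) - 2 * Dval d =
      ((d 0 + 2 - sval d).choose 2 : ℤ) + 3 * sval d - 2 * pval d) ∧
    0 ≤ (((∑ i, d i) + 2).choose 2 : ℤ) - 2 * Dval d ∧
    ∃ F G : Fin r → MvPolynomial (Fin 3) k,
      (∀ i, F i ≠ 0 ∧ (F i).IsHomogeneous (d i)) ∧
      (∀ i, G i ≠ 0 ∧ (G i).IsHomogeneous (d i)) ∧
      (gradedDim (idealOfForms F ⊓ idealOfForms G) (∑ i, d i) : ℤ) =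
        (((∑ i, d i) + 2).choose 2 : ℤ) - 2 * Dval d := by
  have h := expected_dimension_eq hds
  refine ⟨h, ?_, ?_⟩
  · rw [h]
    omega
  · obtain ⟨F, G, hF, hG, hFG⟩ := exists_forms_of_two_mul_pval_le (k := k) hr hanti hpos hds hps
    refine ⟨F, G, hF, hG, ?_⟩
    rw [← hFG]
    push_cast
    ring
end

section
/- Let r ≥ 2 and d₁ ≥ d₂ ≥ ⋯ ≥ d_r ≥ 1 be integers; set s = d₂+⋯+d_r and p = Σ_{2≤i<j≤r} d_i d_j (with p = 0 for r = 2). Then 2p − 3s > 0 if and only if one of the following holds: r = 3, d₃ = 2 and d₂ ≥ 7; r = 3, d₃ = 3 and d₂ ≥ 4; r = 3 and d₃ ≥ 4; r = 4 and d₃ ≥ 2; r = 4 and d₂ ≥ 5; r = 5 and d₂ ≥ 2; r ≥ 6. (Proposition 5.1(i): the complete classification of the partitions with 2p − 3s > 0, which for d₁ ≥ s are exactly the defective cases of σ₂(X_{2,λ}).) -/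
open Finset

/-- Doubling `p` symmetrizes the sum: `2p = Σ_{i ≠ j} d_i d_j` over indices other than the first. -/
lemma two_mul_pval {r : ℕ} (d : Fin r → ℕ) :
    2 * pval d =
      ∑ i ∈ univ.filter (fun i : Fin r => i.val ≠ 0),
        d i * ∑ j ∈ (univ.filter (fun j : Fin r => j.val ≠ 0)).erase i, d j := by
  have hswap : pval d =
      ∑ q ∈ univ.filter (fun q : Fin r × Fin r => q.2 < q.1 ∧ q.2.val ≠ 0), d q.1 * d q.2 := by
    unfold pval
    refine Finset.sum_equiv (Equiv.prodComm _ _) ?_ ?_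
    · simp
    · intro q _
      exact mul_comm _ _
  rw [two_mul]
  nth_rewrite 2 [hswap]
  unfold pval
  rw [Finset.sum_filter, Finset.sum_filter, ← Finset.sum_add_distrib, Fintype.sum_prod_type,
    Finset.sum_filter]
  refine Finset.sum_congr rfl fun i _ => ?_
  rw [← Finset.filter_ne', Finset.filter_filter, Finset.sum_filter, Finset.mul_sum]
  by_cases hi : i.val = 0
  · refine (Finset.sum_eq_zero fun j _ => ?_).trans (by simp [hi])
    have : ¬ (j < i ∧ j.val ≠ 0) := by omega
    simp [hi, this]
  · rw [if_pos hi]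
    refine Finset.sum_congr rfl fun j _ => ?_
    rcases lt_trichotomy i j with h | h | h
    · have : j.val ≠ 0 := by omega
      simp [h, h.not_gt, h.ne', hi, this]
    · simp [h]
    · simp [h, h.not_gt, h.ne, hi]

/-- If there are at least six parts, all positive, then `3s < 2p`. -/
lemma three_sval_lt_two_pval {r : ℕ} (hr : 6 ≤ r) (d : Fin r → ℕ) (hpos : ∀ i, 1 ≤ d i) :
    3 * sval d < 2 * pval d := by
  have hcard : (univ.filter (fun j : Fin r => j.val ≠ 0)).card = r - 1 := by
    obtain ⟨n, rfl⟩ : ∃ n, r = n + 1 := ⟨r - 1, by omega⟩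
    have h : univ.filter (fun j : Fin (n + 1) => j.val ≠ 0) = univ.erase 0 := by
      ext j
      simp
    rw [h, Finset.card_erase_of_mem (mem_univ _), Finset.card_univ, Fintype.card_fin]
  rw [two_mul_pval, sval, Finset.mul_sum]
  refine Finset.sum_lt_sum_of_nonempty (Finset.card_pos.mp (by omega)) fun i hi => ?_
  have hrest : r - 2 ≤ ∑ j ∈ (univ.filter (fun j : Fin r => j.val ≠ 0)).erase i, d j := by
    calc r - 2 = ((univ.filter (fun j : Fin r => j.val ≠ 0)).erase i).card := by
          rw [Finset.card_erase_of_mem hi, hcard]; omega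
      _ = ∑ j ∈ (univ.filter (fun j : Fin r => j.val ≠ 0)).erase i, 1 := by simp
      _ ≤ _ := Finset.sum_le_sum fun j _ => hpos j
  nlinarith [hpos i, show 4 ≤ r - 2 by omega]

/-- Proposition 5.1(i): classification of the partitions with `2p - 3s > 0`. -/
theorem two_p_gt_three_s_classification
    (r : ℕ) [NeZero r] (hr : 2 ≤ r)
    (d : Fin r → ℕ)
    (hanti : ∀ i j : Fin r, i ≤ j → d j ≤ d i)
    (hpos : ∀ i, 1 ≤ d i) :
    3 * sval d < 2 * pval d ↔
      ((r = 3 ∧ d 2 = 2 ∧ 7 ≤ d 1) ∨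
      (r = 3 ∧ d 2 = 3 ∧ 4 ≤ d 1) ∨
      (r = 3 ∧ 4 ≤ d 2) ∨
      (r = 4 ∧ 2 ≤ d 2) ∨
      (r = 4 ∧ 5 ≤ d 1) ∨
      (r = 5 ∧ 2 ≤ d 1) ∨
      6 ≤ r) := by
  rcases Nat.lt_or_ge r 6 with h6 | h6
  · interval_cases r
    · simp [sval, pval, Finset.sum_filter, Fintype.sum_prod_type, Fin.sum_univ_succ]
    · have hs : sval d = d 1 + d 2 := by
        simp [sval, Finset.sum_filter, Fin.sum_univ_succ]
      have hp : pval d = d 1 * d 2 := by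
        simp [pval, Finset.sum_filter, Fintype.sum_prod_type, Fin.sum_univ_succ]
      have h1 := hpos 2
      have h2 := hanti 1 2 (show (1 : ℕ) ≤ 2 by norm_num)
      rw [hs, hp]
      generalize d 1 = a at *
      generalize d 2 = b at *
      simp
      rcases Nat.lt_or_ge b 4 with hb | hb
      · interval_cases b <;> omega
      · exact ⟨fun _ => by omega, fun _ => by nlinarith⟩
    · have hs : sval d = d 1 + d 2 + d 3 := by
        simp [sval, Finset.sum_filter, Fin.sum_univ_succ]
        ring
      have hp : pval d = d 1 * d 2 + d 1 * d 3 + d 2 * d 3 := by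
        simp [pval, Finset.sum_filter, Fintype.sum_prod_type, Fin.sum_univ_succ]
      have h1 := hpos 3
      have h2 := hanti 2 3 (show (2 : ℕ) ≤ 3 by norm_num)
      have h3 := hanti 1 2 (show (1 : ℕ) ≤ 2 by norm_num)
      rw [hs, hp]
      generalize d 1 = a at *
      generalize d 2 = b at *
      generalize d 3 = c at *
      simp
      rcases Nat.lt_or_ge b 2 with hb | hb
      · obtain rfl : b = 1 := by omega
        obtain rfl : c = 1 := by omega
        omega
      · refine ⟨fun _ => by omega, fun _ => ?_⟩
        nlinarith [mul_le_mul h3 hb (by omega) (by omega), mul_le_mul (hb.trans h3) h1 (by omega) (by omega)]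
    · have hs : sval d = d 1 + d 2 + d 3 + d 4 := by
        simp [sval, Finset.sum_filter, Fin.sum_univ_succ]
        ring
      have hp : pval d = d 1 * d 2 + d 1 * d 3 + d 1 * d 4 + d 2 * d 3 + d 2 * d 4 + d 3 * d 4 := by
        simp [pval, Finset.sum_filter, Fintype.sum_prod_type, Fin.sum_univ_succ]
        ring
      have h1 := hpos 4
      have h2 := hanti 3 4 (show (3 : ℕ) ≤ 4 by norm_num)
      have h3 := hanti 2 3 (show (2 : ℕ) ≤ 3 by norm_num)
      have h4 := hanti 1 2 (show (1 : ℕ) ≤ 2 by norm_num)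
      rw [hs, hp]
      generalize d 1 = a at *
      generalize d 2 = b at *
      generalize d 3 = c at *
      generalize d 4 = e at *
      simp
      rcases Nat.lt_or_ge a 2 with ha | ha
      · obtain rfl : a = 1 := by omega
        obtain rfl : b = 1 := by omega
        obtain rfl : c = 1 := by omega
        obtain rfl : e = 1 := by omega
        omega
      · refine ⟨fun _ => by omega, fun _ => ?_⟩
        obtain ⟨e, rfl⟩ := Nat.exists_eq_add_of_le h1
        obtain ⟨c, rfl⟩ := Nat.exists_eq_add_of_le h2
        obtain ⟨b, rfl⟩ := Nat.exists_eq_add_of_le h3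
        obtain ⟨a, rfl⟩ := Nat.exists_eq_add_of_le h4
        ring_nf at *
        nlinarith
  · have := three_sval_lt_two_pval h6 d hpos
    exact ⟨fun _ => by omega, fun _ => this⟩
end

section
/- Let r ≥ 2 and d₁ ≥ d₂ ≥ ⋯ ≥ d_r ≥ 1 be integers; set s = d₂+⋯+d_r and p = Σ_{2≤i<j≤r} d_i d_j (with p = 0 for r = 2). Then 2p − 3s ≤ 0 if and only if one of the following holds: r = 2; r = 3 and (d₂,d₃) ∈ {(a,1) : a ≥ 1} ∪ {(2,2), (3,2), (4,2), (5,2), (6,2), (3,3)}; r = 4 and (d₂,d₃,d₄) ∈ {(1,1,1), (2,1,1), (3,1,1), (4,1,1)}; r = 5 and (d₂,d₃,d₄,d₅) = (1,1,1,1). (Remark 5.2: the complete classification of partitions with 2p − 3s ≤ 0, which for d₁ ≥ s are exactly the nondefective cases of σ₂(X_{2,λ}).) -/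
open Finset

theorem mul_sval_le_two_mul_pval {r : ℕ} (d : Fin r → ℕ) (hpos : ∀ i, 1 ≤ d i) :
    (r - 2) * sval d ≤ 2 * pval d := by
  have hmul (a b : ℕ) (ha : 1 ≤ a) (hb : 1 ≤ b) : a + b ≤ 2 * (a * b) := by nlinarith
  have hsplit : ∑ i ∈ univ.filter (fun i : Fin r => i.val ≠ 0),
      ∑ j ∈ univ.filter (fun j : Fin r => j.val ≠ 0 ∧ j ≠ i), d i =
      ∑ q ∈ univ.filter (fun q : Fin r × Fin r => q.1 < q.2 ∧ q.1.val ≠ 0),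
        (d q.1 + d q.2) := by
    simp only [sum_filter, Fintype.sum_prod_type]
    have hswap : ∑ i : Fin r, ∑ j : Fin r, (if i < j ∧ i.val ≠ 0 then d j else 0) =
        ∑ i : Fin r, ∑ j : Fin r, (if j < i ∧ j.val ≠ 0 then d i else 0) := sum_comm
    have hadd : ∑ i : Fin r, ∑ j : Fin r, (if i < j ∧ i.val ≠ 0 then d i + d j else 0) =
        ∑ i : Fin r, ∑ j : Fin r, (if i < j ∧ i.val ≠ 0 then d i else 0) +
        ∑ i : Fin r, ∑ j : Fin r, (if i < j ∧ i.val ≠ 0 then d j else 0) := by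
      simp only [← sum_add_distrib]
      refine sum_congr rfl fun i _ => sum_congr rfl fun j _ => ?_
      split_ifs <;> rfl
    rw [hadd, hswap, ← sum_add_distrib]
    refine sum_congr rfl fun i _ => ?_
    rw [← sum_add_distrib]
    by_cases hi : i.val = 0
    · rw [if_neg (by simpa using hi)]
      symm
      refine sum_eq_zero fun j _ => ?_
      simp only [Fin.lt_def]
      split_ifs <;> omega
    · rw [if_pos hi]
      refine sum_congr rfl fun j _ => ?_
      simp only [Fin.lt_def, Ne, Fin.ext_iff]
      split_ifs <;> omega
  have hcard (i : Fin r) (hi : i.val ≠ 0) :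
      (univ.filter (fun j : Fin r => j.val ≠ 0 ∧ j ≠ i)).card = r - 2 := by
    have h0 : 0 < r := i.pos
    have heq : univ.filter (fun j : Fin r => j.val ≠ 0 ∧ j ≠ i) =
        (univ.erase (⟨0, h0⟩ : Fin r)).erase i := by
      ext j
      simp [Fin.ext_iff, and_comm]
    rw [heq, card_erase_of_mem (by simpa [Fin.ext_iff] using hi),
      card_erase_of_mem (mem_univ _), card_univ, Fintype.card_fin]
    omega
  calc (r - 2) * sval d
      = ∑ i ∈ univ.filter (fun i : Fin r => i.val ≠ 0),
          ∑ j ∈ univ.filter (fun j : Fin r => j.val ≠ 0 ∧ j ≠ i), d i := by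
        rw [sval, mul_sum]
        refine sum_congr rfl fun i hi => ?_
        rw [sum_const, hcard i (mem_filter.1 hi).2, smul_eq_mul]
    _ ≤ 2 * pval d := by
        rw [hsplit, pval, mul_sum]
        exact sum_le_sum fun q _ => hmul _ _ (hpos _) (hpos _)

theorem two_mul_mul_le_iff {a b : ℕ} (hab : b ≤ a) (hb : 1 ≤ b) :
    2 * (a * b) ≤ 3 * (a + b) ↔ b = 1 ∨ (b = 2 ∧ a ≤ 6) ∨ (a = 3 ∧ b = 3) := by
  constructor
  · intro h
    have hb3 : b ≤ 3 := by nlinarith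
    interval_cases b <;> omega
  · rintro (rfl | ⟨rfl, h⟩ | ⟨rfl, rfl⟩) <;> omega

theorem two_mul_add_le_iff {a b c : ℕ} (hab : b ≤ a) (hbc : c ≤ b) (hc : 1 ≤ c) :
    2 * (a * b + a * c + b * c) ≤ 3 * (a + b + c) ↔ b = 1 ∧ c = 1 ∧ a ≤ 4 := by
  constructor
  · intro h
    have hb1 : b = 1 := by
      by_contra hne
      have hb2 : 2 ≤ b := by omega
      nlinarith [Nat.mul_le_mul_left a hb2, Nat.mul_le_mul_left a hc, Nat.mul_le_mul_left b hc]
    obtain rfl : c = 1 := by omega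
    subst hb1
    omega
  · rintro ⟨rfl, rfl, h⟩
    omega

theorem two_mul_add_six_le_iff {a b c e : ℕ} (hab : b ≤ a) (hbc : c ≤ b) (hce : e ≤ c)
    (he : 1 ≤ e) :
    2 * (a * b + a * c + a * e + b * c + b * e + c * e) ≤ 3 * (a + b + c + e) ↔
      a = 1 ∧ b = 1 ∧ c = 1 ∧ e = 1 := by
  constructor
  · intro h
    have ha : a = 1 := by
      by_contra hne
      have hc : 1 ≤ c := by omega
      have hb : 1 ≤ b := by omega
      have ha2 : 2 ≤ a := by omega
      nlinarith [Nat.mul_le_mul ha2 hb, mul_le_mul' hb hc, mul_le_mul' hb he, mul_le_mul' hc he]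
    omega
  · rintro ⟨rfl, rfl, rfl, rfl⟩
    norm_num

theorem sval_fin_three (d : Fin 3 → ℕ) : sval d = d 1 + d 2 := by
  simp [sval, sum_filter, Fin.sum_univ_three]

theorem pval_fin_three (d : Fin 3 → ℕ) :
    pval d = d 1 * d 2 := by
  simp [pval, sum_filter, Fintype.sum_prod_type, Fin.sum_univ_three]

theorem sval_fin_four (d : Fin 4 → ℕ) : sval d = d 1 + d 2 + d 3 := by
  simp [sval, sum_filter, Fin.sum_univ_four]

theorem pval_fin_four (d : Fin 4 → ℕ) :
    pval d = d 1 * d 2 + d 1 * d 3 + d 2 * d 3 := by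
  simp [pval, sum_filter, Fintype.sum_prod_type, Fin.sum_univ_four, ← add_assoc]

theorem sval_fin_five (d : Fin 5 → ℕ) : sval d = d 1 + d 2 + d 3 + d 4 := by
  simp [sval, sum_filter, Fin.sum_univ_five]

theorem pval_fin_five (d : Fin 5 → ℕ) :
    pval d = d 1 * d 2 + d 1 * d 3 + d 1 * d 4 + d 2 * d 3 + d 2 * d 4 + d 3 * d 4 := by
  simp [pval, sum_filter, Fintype.sum_prod_type, Fin.sum_univ_five, ← add_assoc]

/-- Remark 5.2: classification of the partitions with `2p - 3s ≤ 0`. -/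
theorem two_p_le_three_s_classification
    (r : ℕ) [NeZero r] (hr : 2 ≤ r)
    (d : Fin r → ℕ)
    (hanti : ∀ i j : Fin r, i ≤ j → d j ≤ d i)
    (hpos : ∀ i, 1 ≤ d i) :
    2 * pval d ≤ 3 * sval d ↔
      (r = 2 ∨
      (r = 3 ∧ ((∃ a : ℕ, 1 ≤ a ∧ d 1 = a ∧ d 2 = 1) ∨
        (d 1 = 2 ∧ d 2 = 2) ∨ (d 1 = 3 ∧ d 2 = 2) ∨ (d 1 = 4 ∧ d 2 = 2) ∨
        (d 1 = 5 ∧ d 2 = 2) ∨ (d 1 = 6 ∧ d 2 = 2) ∨ (d 1 = 3 ∧ d 2 = 3))) ∨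
      (r = 4 ∧ ((d 1 = 1 ∧ d 2 = 1 ∧ d 3 = 1) ∨ (d 1 = 2 ∧ d 2 = 1 ∧ d 3 = 1) ∨
        (d 1 = 3 ∧ d 2 = 1 ∧ d 3 = 1) ∨ (d 1 = 4 ∧ d 2 = 1 ∧ d 3 = 1))) ∨
      (r = 5 ∧ d 1 = 1 ∧ d 2 = 1 ∧ d 3 = 1 ∧ d 4 = 1)) := by
  obtain hr6 | hr6 := le_or_gt 6 r
  · have hle := mul_sval_le_two_mul_pval d hpos
    have h4 : 4 * sval d ≤ (r - 2) * sval d := Nat.mul_le_mul_right _ (by omega)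
    have hs : 1 ≤ sval d :=
      (hpos ⟨1, by omega⟩).trans (single_le_sum (f := d) (fun _ _ => Nat.zero_le _) (by simp))
    omega
  · interval_cases r
    · simp [pval, sval, sum_filter, Fintype.sum_prod_type, Fin.sum_univ_succ]
    · obtain rfl : ‹NeZero 3› = Nat.instNeZeroSucc := rfl
      have h12 : d 2 ≤ d 1 := hanti 1 2 (by decide)
      have h2 := hpos 2
      have hex : (∃ a : ℕ, 1 ≤ a ∧ d 1 = a ∧ d 2 = 1) ↔ d 2 = 1 :=
        ⟨fun ⟨_, _, _, h⟩ => h, fun h => ⟨d 1, hpos 1, rfl, h⟩⟩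
      rw [pval_fin_three, sval_fin_three, two_mul_mul_le_iff h12 h2, hex]
      simp only [Nat.reduceEqDiff, false_and, true_and, false_or, or_false]
      constructor <;> intro h <;> omega
    · obtain rfl : ‹NeZero 4› = Nat.instNeZeroSucc := rfl
      have h12 : d 2 ≤ d 1 := hanti 1 2 (by decide)
      have h23 : d 3 ≤ d 2 := hanti 2 3 (by decide)
      have h3 := hpos 3
      rw [pval_fin_four, sval_fin_four, two_mul_add_le_iff h12 h23 h3]
      simp only [Nat.reduceEqDiff, false_and, true_and, false_or, or_false]
      constructor <;> intro h <;> omega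
    · obtain rfl : ‹NeZero 5› = Nat.instNeZeroSucc := rfl
      have h12 : d 2 ≤ d 1 := hanti 1 2 (by decide)
      have h23 : d 3 ≤ d 2 := hanti 2 3 (by decide)
      have h34 : d 4 ≤ d 3 := hanti 3 4 (by decide)
      have h4 := hpos 4
      rw [pval_fin_five, sval_fin_five, two_mul_add_six_le_iff h12 h23 h34 h4]
      simp only [Nat.reduceEqDiff, false_and, true_and, false_or]
end
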